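/- arXiv:2406.01404 — 3 statements merged into one kernel-verified Lean document; each statement's English description precedes it below -/
import Mathlib

section
/- A map f : U → ℓ² from an open subset U of ℓ², written in coordinates as f(z) = (f₁(z), f₂(z), …), is holomorphic if and only if every coordinate function fₖ : U → ℂ is holomorphic and the function z ↦ ‖f(z)‖² = Σₖ |fₖ(z)|² is locally bounded on U. -/
/- STATEMENT 1: a map into ℓ² is holomorphic iff all coordinate functions are
holomorphic and the norm is locally bounded. -/

noncomputable section
open Set

abbrev EllTwo : Type := lp (fun _ : ℕ => ℂ) 2

open Metric Filter Topology Asymptotics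

section Schwarz

variable {E F : Type*} [NormedAddCommGroup E] [NormedSpace ℂ E]
  [NormedAddCommGroup F] [NormedSpace ℂ F]

theorem norm_fderiv_le_of_differentiableOn_ball_of_norm_le {g : E → F} {a : E} {R M : ℝ}
    (hR : 0 < R) (hg : DifferentiableOn ℂ g (ball a R)) (hM : ∀ z ∈ ball a R, ‖g z‖ ≤ M) :
    ‖fderiv ℂ g a‖ ≤ 2 * M / R := by
  refine Complex.norm_fderiv_le_div_of_mapsTo_ball hg (fun z hz => ?_) hR
  rw [mem_closedBall, dist_eq_norm]
  linarith [norm_sub_le (g z) (g a), hM z hz, hM a (mem_ball_self hR)]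

theorem norm_sub_sub_fderiv_le_of_differentiableOn_ball_of_norm_le {g : E → F} {a z : E}
    {R M : ℝ} (hg : DifferentiableOn ℂ g (ball a R)) (hM : ∀ z ∈ ball a R, ‖g z‖ ≤ M)
    (hz : z ∈ ball a R) :
    ‖g z - g a - fderiv ℂ g a (z - a)‖ ≤ 4 * M * (‖z - a‖ / R) ^ 2 := by
  have hR : 0 < R := nonempty_ball.1 ⟨z, hz⟩
  have hD := norm_fderiv_le_of_differentiableOn_ball_of_norm_le hR hg hM
  have hda : DifferentiableAt ℂ g a := hg.differentiableAt (ball_mem_nhds a hR)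
  set r : E → F := fun w => g w - g a - fderiv ℂ g a (w - a)
  have hra : r a = 0 := by simp [r]
  have hr : DifferentiableOn ℂ r (ball a R) := (hg.sub_const _).sub (by fun_prop)
  have hmaps : MapsTo r (ball a R) (closedBall (r a) (4 * M)) := fun w hw => by
    rw [hra, mem_closedBall_zero_iff]
    have hlin : ‖fderiv ℂ g a (w - a)‖ ≤ 2 * M := calc
      _ ≤ 2 * M / R * R :=
        (fderiv ℂ g a).le_of_opNorm_le_of_le hD (mem_ball_iff_norm.1 hw).le
      _ = 2 * M := div_mul_cancel₀ _ hR.ne'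
    linarith [norm_sub_le (g w - g a) (fderiv ℂ g a (w - a)), norm_sub_le (g w) (g a),
      hM w hw, hM a (mem_ball_self hR)]
  have ho : (r · - r a) =o[𝓝 a] fun w => ‖w - a‖ ^ 1 := by
    simpa [hra, r] using hda.hasFDerivAt.isLittleO.norm_right
  change ‖r z‖ ≤ _
  simpa [hra, dist_eq_norm] using
    Complex.dist_le_mul_div_pow_of_mapsTo_ball_of_isLittleO hr hmaps ho hz

end Schwarz

namespace lp

variable {ι : Type*} [DecidableEq ι] {G : ι → Type*} [∀ i, NormedAddCommGroup (G i)] {p : ENNReal}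

theorem norm_sum_single_le (hp : 0 < p.toReal) (x : lp G p) (s : Finset ι) :
    ‖∑ i ∈ s, lp.single p i (x i)‖ ≤ ‖x‖ := by
  rw [← Real.rpow_le_rpow_iff (norm_nonneg' _) (norm_nonneg' _) hp, lp.norm_sum_single hp]
  exact lp.sum_rpow_le_norm_rpow hp x s

theorem memℓp_of_norm_sum_single_le (hp : 0 < p.toReal) {v : ∀ i, G i} {C : ℝ}
    (h : ∀ s : Finset ι, ‖∑ i ∈ s, lp.single p i (v i)‖ ≤ C) : Memℓp v p :=
  memℓp_gen' (C := C ^ p.toReal) fun s => by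
    rw [← lp.norm_sum_single hp]
    exact Real.rpow_le_rpow (norm_nonneg' _) (h s) hp.le

theorem norm_le_of_norm_sum_single_le (hp : 0 < p.toReal) {x : lp G p} {C : ℝ}
    (h : ∀ s : Finset ι, ‖∑ i ∈ s, lp.single p i (x i)‖ ≤ C) : ‖x‖ ≤ C :=
  lp.norm_le_of_forall_sum_le hp ((norm_nonneg' _).trans (h ∅)) fun s => by
    rw [← lp.norm_sum_single hp]
    exact Real.rpow_le_rpow (norm_nonneg' _) (h s) hp.le

variable {E : Type*} [NormedAddCommGroup E] [NormedSpace ℂ E] [∀ i, NormedSpace ℂ (G i)]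
  [Fact (1 ≤ p)]

/-- A bounded map on a ball into `ℓᵖ`, `p < ∞`, with holomorphic coordinates is differentiable at
the centre. -/
theorem differentiableAt_of_forall_coord_of_norm_le (hp : p ≠ ⊤) {f : E → lp G p} {a : E}
    {R M : ℝ} (hR : 0 < R) (hf : ∀ i, DifferentiableOn ℂ (fun z => f z i) (ball a R))
    (hM : ∀ z ∈ ball a R, ‖f z‖ ≤ M) : DifferentiableAt ℂ f a := by
  have hp₀ : 0 < p.toReal := ENNReal.toReal_pos (zero_lt_one.trans_le Fact.out).ne' hp
  set T : Finset ι → E → lp G p := fun s z => ∑ i ∈ s, lp.single p i (f z i)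
  have hT : ∀ s, DifferentiableOn ℂ (T s) (ball a R) := fun s =>
    DifferentiableOn.fun_sum fun i _ =>
      (lp.singleContinuousLinearMap ℂ G p i).differentiable.comp_differentiableOn (hf i)
  have hTM : ∀ s, ∀ z ∈ ball a R, ‖T s z‖ ≤ M := fun s z hz =>
    (norm_sum_single_le hp₀ (f z) s).trans (hM z hz)
  set D : ∀ i, E →L[ℂ] G i := fun i => fderiv ℂ (fun z => f z i) a
  have hTD : ∀ s h, fderiv ℂ (T s) a h = ∑ i ∈ s, lp.single p i (D i h) := fun s h => by
    have : HasFDerivAt (T s)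
        (∑ i ∈ s, (lp.singleContinuousLinearMap ℂ G p i).comp (D i)) a :=
      HasFDerivAt.fun_sum fun i _ =>
        (lp.singleContinuousLinearMap ℂ G p i).hasFDerivAt.comp a
          ((hf i).differentiableAt (ball_mem_nhds a hR)).hasFDerivAt
    simp [this.fderiv]
  have hbound : ∀ h (s : Finset ι), ‖∑ i ∈ s, lp.single p i (D i h)‖ ≤ 2 * M / R * ‖h‖ :=
    fun h s => hTD s h ▸ (fderiv ℂ (T s) a).le_of_opNorm_le
      (norm_fderiv_le_of_differentiableOn_ball_of_norm_le hR (hT s) (hTM s)) h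
  let L₀ : E →ₗ[ℂ] lp G p :=
    { toFun := fun h => ⟨fun i => D i h, memℓp_of_norm_sum_single_le hp₀ (hbound h)⟩
      map_add' := fun x y => lp.ext <| funext fun i => map_add (D i) x y
      map_smul' := fun c x => lp.ext <| funext fun i => map_smul (D i) c x }
  let L : E →L[ℂ] lp G p := L₀.mkContinuous (2 * M / R) fun h =>
    norm_le_of_norm_sum_single_le hp₀ (hbound h)
  have hrem : ∀ z ∈ ball a R, ‖f z - f a - L (z - a)‖ ≤ 4 * M * (‖z - a‖ / R) ^ 2 :=
    fun z hz => norm_le_of_norm_sum_single_le hp₀ fun s => by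
      refine le_trans (le_of_eq ?_)
        (norm_sub_sub_fderiv_le_of_differentiableOn_ball_of_norm_le (hT s) (hTM s) hz)
      rw [hTD, ← Finset.sum_sub_distrib, ← Finset.sum_sub_distrib]
      simp_rw [← lp.single_sub]
      rfl
  have hO : (fun z => f z - f a - L (z - a)) =O[𝓝 a] fun z => ‖z - a‖ ^ 2 :=
    IsBigO.of_bound (4 * M / R ^ 2) <| by
      filter_upwards [ball_mem_nhds a hR] with z hz
      refine (hrem z hz).trans_eq ?_
      rw [norm_pow, norm_norm]
      ring
  exact HasFDerivAt.differentiableAt (f' := L)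
    (.of_isLittleO (hO.trans_isLittleO (isLittleO_pow_sub_sub a one_lt_two)))

end lp

theorem holomorphic_iff_coords_and_locally_bounded
    (U : Set EllTwo) (hU : IsOpen U) (f : EllTwo → EllTwo) :
    DifferentiableOn ℂ f U ↔
      ((∀ k : ℕ, DifferentiableOn ℂ (fun z => (f z : ∀ _ : ℕ, ℂ) k) U) ∧
        ∀ a ∈ U, ∃ V ∈ nhds a, ∃ M : ℝ, ∀ z ∈ V ∩ U, ‖f z‖ ≤ M) := by
  refine ⟨fun hf => ⟨fun k => ?_, fun a ha => ?_⟩, fun ⟨hf, hbd⟩ a ha => ?_⟩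
  · exact (lp.evalCLM ℂ (fun _ : ℕ => ℂ) 2 k).differentiable.comp_differentiableOn hf
  · have hc : ContinuousAt f a := hf.continuousOn.continuousAt (hU.mem_nhds ha)
    exact ⟨_, hc.norm.eventually (gt_mem_nhds (lt_add_one ‖f a‖)), ‖f a‖ + 1,
      fun z hz => le_of_lt hz.1⟩
  · obtain ⟨V, hV, M, hM⟩ := hbd a ha
    obtain ⟨R, hR, hsub⟩ := Metric.mem_nhds_iff.1 (inter_mem hV (hU.mem_nhds ha))
    exact (lp.differentiableAt_of_forall_coord_of_norm_le ENNReal.ofNat_ne_top hR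
      (fun k => (hf k).mono (hsub.trans inter_subset_right))
      fun z hz => hM z (hsub hz)).differentiableWithinAt
end
end

section
/- Let f be a holomorphic function on an open neighbourhood of a point a in ℓ² with f(a) = 0 but f not identically zero near a. Then there exist a vector v ∈ ℓ², a closed hyperplane E' with ℓ² = E' ⊕ ℂv, a neighbourhood 𝒱 of 0, an integer k ≥ 1, holomorphic functions c₁, …, c_k on a neighbourhood of 0 in E' with c_j(0) = 0, and a nonvanishing holomorphic function φ on 𝒱, such that for all z = z' + λv ∈ 𝒱, f(z + a) = (λ^k + Σ_{j=1}^k c_j(z') λ^{k−j}) · φ(z). -/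
noncomputable section
open Set Metric

/-- A meromorphic function on an open subset `U` of a complex normed space:
locally a quotient `h/g` of holomorphic functions with `g ≢ 0`. -/
def MeromorphicOnSet {E : Type*} [NormedAddCommGroup E] [NormedSpace ℂ E]
    (f : E → ℂ) (U : Set E) : Prop :=
  ∀ a ∈ U, ∃ V : Set E, IsOpen V ∧ a ∈ V ∧ V ⊆ U ∧ ∃ h g : E → ℂ,
    DifferentiableOn ℂ h V ∧ DifferentiableOn ℂ g V ∧ (∃ z ∈ V, g z ≠ 0) ∧
    ∀ z ∈ V, g z ≠ 0 → f z = h z / g z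

/-- A Hilbert analytic subset of an open set `U`: locally the zero set of a
holomorphic map with values in a separable complex Hilbert space. -/
def IsHilbertAnalyticIn {E : Type*} [NormedAddCommGroup E] [NormedSpace ℂ E]
    (A U : Set E) : Prop :=
  A ⊆ U ∧ ∀ a ∈ U, ∃ V : Set E, IsOpen V ∧ a ∈ V ∧ V ⊆ U ∧
    ∃ h : E → EllTwo, DifferentiableOn ℂ h V ∧ A ∩ V = {z ∈ V | h z = 0}

/-- The germ of `A` at `a` has codimension at least `p`: there is a
`p`-dimensional linear subspace `T` such that, locally near `a`, the affine
subspace `a + T` meets `A` only at `a`. -/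
def GermCodimAtLeast {E : Type*} [NormedAddCommGroup E] [NormedSpace ℂ E]
    (A : Set E) (a : E) (p : ℕ) : Prop :=
  ∃ T : Submodule ℂ E, Module.finrank ℂ T = p ∧ ∃ V : Set E, IsOpen V ∧ a ∈ V ∧
    ∀ z ∈ A ∩ V, z - a ∈ (T : Set E) → z = a

/-- `A` contains a principal germ at `a`: the germ of the zero set of a single
holomorphic function vanishing at `a` (and not identically zero) is contained
in `A`. -/
def ContainsPrincipalGermAt {E : Type*} [NormedAddCommGroup E] [NormedSpace ℂ E]
    (A : Set E) (a : E) : Prop :=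
  ∃ V : Set E, IsOpen V ∧ a ∈ V ∧ ∃ f : E → ℂ,
    DifferentiableOn ℂ f V ∧ f a = 0 ∧ (∃ z ∈ V, f z ≠ 0) ∧
    ∃ W : Set E, IsOpen W ∧ a ∈ W ∧ W ⊆ V ∧ {z ∈ W | f z = 0} ⊆ A

open Filter Topology in
/-- The derivative of a holomorphic function on a complex normed space is continuous. -/
theorem continuousOn_fderiv_of_differentiableOn_complex {E F : Type*} [NormedAddCommGroup E]
    [NormedSpace ℂ E] [NormedAddCommGroup F] [NormedSpace ℂ F] {f : E → F} {Ω : Set E}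
    (hf : DifferentiableOn ℂ f Ω) (hΩ : IsOpen Ω) : ContinuousOn (fderiv ℂ f) Ω := by
  intro x₀ hx₀
  apply ContinuousAt.continuousWithinAt
  have hev : ∀ᶠ y in 𝓝 x₀, y ∈ Ω ∧ dist (f y) (f x₀) < 1 :=
    (hΩ.eventually_mem hx₀).and
      (Metric.tendsto_nhds.mp ((hf.differentiableAt (hΩ.mem_nhds hx₀)).continuousAt) 1 one_pos)
  obtain ⟨ε, hε, hball⟩ := Metric.eventually_nhds_iff_ball.mp hev
  obtain ⟨r, hr, rfl⟩ : ∃ r, 0 < r ∧ ε = 4 * r := ⟨ε / 4, by positivity, by ring⟩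
  have hdiff : ∀ x ∈ ball x₀ (4 * r), DifferentiableAt ℂ f x := fun x hx =>
    hf.differentiableAt (hΩ.mem_nhds (hball x hx).1)
  have hbound : ∀ x ∈ ball x₀ (2 * r), ‖fderiv ℂ f x‖ ≤ 1 / r := by
    intro x hx
    have hsub : ball x (2 * r) ⊆ ball x₀ (4 * r) :=
      ball_subset_ball' (by rw [mem_ball] at hx; linarith)
    have h := Complex.norm_fderiv_le_div_of_mapsTo_ball (f := f) (c := x) (R₁ := 2 * r) (R₂ := 2)
      (fun y hy => (hdiff y (hsub hy)).differentiableWithinAt)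
      (fun y hy => by
        have h1 := (hball y (hsub hy)).2
        have h2 := (hball x (ball_subset_ball (by linarith) hx)).2
        rw [mem_closedBall]
        linarith [dist_triangle_right (f y) (f x) (f x₀)]) (by positivity)
    refine h.trans_eq ?_
    field_simp
  have hlip : ∀ x ∈ ball x₀ (2 * r), ∀ y ∈ ball x₀ (2 * r), ‖f y - f x‖ ≤ 1 / r * ‖y - x‖ :=
    fun x hx y hy => (convex_ball x₀ (2 * r)).norm_image_sub_le_of_norm_fderiv_le (𝕜 := ℂ)
      (fun z hz => hdiff z (ball_subset_ball (by linarith) hz)) hbound hx hy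
  have hmain : ∀ x ∈ ball x₀ r, ‖fderiv ℂ f x - fderiv ℂ f x₀‖ ≤ 2 / r ^ 2 * ‖x - x₀‖ := by
    intro x hx
    rw [mem_ball_iff_norm] at hx
    set g : E → F := fun w => f (w + (x - x₀)) - f w with hg
    have hmem : ∀ w ∈ ball x₀ r, w + (x - x₀) ∈ ball x₀ (2 * r) := by
      intro w hw
      rw [mem_ball_iff_norm] at hw ⊢
      calc ‖w + (x - x₀) - x₀‖ = ‖(w - x₀) + (x - x₀)‖ := by congr 1; abel
        _ ≤ ‖w - x₀‖ + ‖x - x₀‖ := norm_add_le _ _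
        _ < 2 * r := by linarith
    have hgd : ∀ w ∈ ball x₀ r, HasFDerivAt g
        (fderiv ℂ f (w + (x - x₀)) - fderiv ℂ f w) w := by
      intro w hw
      refine HasFDerivAt.sub ?_ (hdiff w (ball_subset_ball (by linarith) hw)).hasFDerivAt
      exact (hasFDerivAt_comp_add_right _).2
        (hdiff _ (ball_subset_ball (by linarith) (hmem w hw))).hasFDerivAt
    have hgb : ∀ w ∈ ball x₀ r, ‖g w‖ ≤ 1 / r * ‖x - x₀‖ := by
      intro w hw
      have := hlip w (ball_subset_ball (by linarith) hw) _ (hmem w hw)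
      simpa using this
    have h := Complex.norm_fderiv_le_div_of_mapsTo_ball (f := g) (c := x₀) (R₁ := r)
      (R₂ := 2 * (1 / r * ‖x - x₀‖))
      (fun y hy => (hgd y hy).differentiableAt.differentiableWithinAt)
      (fun y hy => by
        rw [mem_closedBall, dist_eq_norm]
        linarith [norm_sub_le (g y) (g x₀), hgb y hy, hgb x₀ (mem_ball_self hr)]) hr
    rw [(hgd x₀ (mem_ball_self hr)).fderiv] at h
    simp only [add_sub_cancel] at h
    refine h.trans_eq ?_
    field_simp
  rw [ContinuousAt, tendsto_iff_norm_sub_tendsto_zero]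
  refine squeeze_zero' (Eventually.of_forall fun _ => norm_nonneg _)
    (eventually_of_mem (ball_mem_nhds x₀ hr) hmain) ?_
  have : Continuous fun x : E => 2 / r ^ 2 * ‖x - x₀‖ := by fun_prop
  simpa using this.tendsto x₀

open Filter Topology in
/-- A circle integral of a jointly holomorphic function depends holomorphically on the
parameter. -/
theorem differentiableAt_circleIntegral_param {E F : Type*} [NormedAddCommGroup E]
    [NormedSpace ℂ E] [NormedAddCommGroup F] [NormedSpace ℂ F] [CompleteSpace F]
    {H : E × ℂ → F} {Ω : Set (E × ℂ)} (hH : DifferentiableOn ℂ H Ω) (hΩ : IsOpen Ω)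
    {c : ℂ} {R : ℝ} (hR : 0 ≤ R) {x₀ : E} (hx₀ : ∀ ζ ∈ sphere c R, (x₀, ζ) ∈ Ω) :
    DifferentiableAt ℂ (fun x => ∮ ζ in C(c, R), H (x, ζ)) x₀ := by
  have hcont := continuousOn_fderiv_of_differentiableOn_complex hH hΩ
  have hdiff : ∀ p ∈ Ω, DifferentiableAt ℂ H p := fun p hp =>
    hH.differentiableAt (hΩ.mem_nhds hp)
  obtain ⟨M, hM⟩ : ∃ M : ℝ, ∀ ζ ∈ sphere c R, ‖fderiv ℂ H (x₀, ζ)‖ ≤ M :=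
    (isCompact_sphere c R).exists_bound_of_continuousOn
      (hcont.comp (by fun_prop) hx₀)
  have hΩ' : IsOpen (Ω ∩ {p | ‖fderiv ℂ H p‖ < M + 1}) :=
    hcont.norm.isOpen_inter_preimage hΩ isOpen_Iio
  obtain ⟨u, v, hu, -, hxu, hKv, huv⟩ := generalized_tube_lemma (isCompact_singleton (x := x₀))
    (isCompact_sphere c R) hΩ' (by
      rintro ⟨x, ζ⟩ ⟨rfl, hζ⟩
      exact ⟨hx₀ ζ hζ, (hM ζ hζ).trans_lt (lt_add_one M)⟩)
  have hu' : ∀ x ∈ u, ∀ t : ℝ, (x, circleMap c R t) ∈ Ω ∩ {p | ‖fderiv ℂ H p‖ < M + 1} :=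
    fun x hx t => huv ⟨hx, hKv (circleMap_mem_sphere c hR t)⟩
  have hun : u ∈ 𝓝 x₀ := hu.mem_nhds (hxu rfl)
  have hFc : ∀ x ∈ u, Continuous fun t : ℝ =>
      deriv (circleMap c R) t • H (x, circleMap c R t) := by
    intro x hx
    have h1 : Continuous fun t : ℝ => H (x, circleMap c R t) :=
      hH.continuousOn.comp_continuous (by fun_prop) fun t => (hu' x hx t).1
    simp only [deriv_circleMap]
    exact ((continuous_circleMap 0 R).mul continuous_const).smul h1
  have hF'c : Continuous fun t : ℝ => deriv (circleMap c R) t •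
      (fderiv ℂ H (x₀, circleMap c R t)).comp (ContinuousLinearMap.inl ℂ E ℂ) := by
    have h1 : Continuous fun t : ℝ => fderiv ℂ H (x₀, circleMap c R t) :=
      hcont.comp_continuous (by fun_prop) fun t => (hu' x₀ (hxu rfl) t).1
    simp only [deriv_circleMap]
    fun_prop
  have key := intervalIntegral.hasFDerivAt_integral_of_dominated_of_fderiv_le
    (𝕜 := ℂ) (μ := MeasureTheory.volume) (a := 0) (b := 2 * Real.pi) (x₀ := x₀) (s := u)
    (F := fun x t => deriv (circleMap c R) t • H (x, circleMap c R t))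
    (F' := fun x t => deriv (circleMap c R) t •
      (fderiv ℂ H (x, circleMap c R t)).comp (ContinuousLinearMap.inl ℂ E ℂ))
    (bound := fun _ => R * ((M + 1) * 1)) hun
    (eventually_of_mem hun fun x hx => (hFc x hx).aestronglyMeasurable)
    ((hFc x₀ (hxu rfl)).intervalIntegrable _ _) hF'c.aestronglyMeasurable
    (by
      refine Eventually.of_forall fun t _ x hx => ?_
      rw [norm_smul]
      have h1 : ‖deriv (circleMap c R) t‖ = R := by simp [abs_of_nonneg hR]
      rw [h1]
      gcongr
      refine (ContinuousLinearMap.opNorm_comp_le _ _).trans ?_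
      exact mul_le_mul (hu' x hx t).2.le (ContinuousLinearMap.norm_inl_le_one ℂ E ℂ)
        (norm_nonneg _) ((norm_nonneg _).trans (hu' x hx t).2.le))
    (by simp)
    (by
      refine Eventually.of_forall fun t _ x hx => ?_
      have h1 := (hdiff _ (hu' x hx t).1).hasFDerivAt
      have h2 : HasFDerivAt (fun y : E => (y, circleMap c R t))
        (ContinuousLinearMap.inl ℂ E ℂ) x := hasFDerivAt_prodMk_left x _
      exact (h1.comp x h2).const_smul _)
  exact key.differentiableAt

/-- Laurent splitting: a holomorphic function on an annulus is the sum of the Cauchy integral over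
an outer circle and a function of `z⁻¹` holomorphic near `0` and vanishing there. -/
theorem exists_laurent_splitting {l : ℂ → ℂ} {r₀ ρ r r₁ : ℝ} (h₀ : 0 < r₀) (h₀ρ : r₀ < ρ)
    (hρr : ρ < r) (hr₁ : r < r₁) (hl : DifferentiableOn ℂ l (ball 0 r₁ \ closedBall 0 r₀)) :
    ∃ g : ℂ → ℂ, DifferentiableOn ℂ g (ball 0 ρ⁻¹) ∧ g 0 = 0 ∧
      ∀ z : ℂ, ρ < ‖z‖ → ‖z‖ < r →
        l z = (2 * Real.pi * Complex.I)⁻¹ * (∮ ζ in C(0, r), l ζ / (ζ - z)) + g z⁻¹ := by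
  have hρ : 0 < ρ := h₀.trans h₀ρ
  have hr : 0 < r := hρ.trans hρr
  have hA : IsOpen (ball (0 : ℂ) r₁ \ closedBall 0 r₀) := isOpen_ball.sdiff isClosed_closedBall
  have hsph : ∀ s, ρ ≤ s → s ≤ r → sphere (0 : ℂ) s ⊆ ball 0 r₁ \ closedBall 0 r₀ := by
    intro s h1 h2 ζ hζ
    rw [mem_sphere_zero_iff_norm] at hζ
    simp only [mem_sdiff, mem_ball_zero_iff, mem_closedBall_zero_iff, not_le, hζ]
    constructor <;> linarith
  refine ⟨fun w => (2 * Real.pi * Complex.I)⁻¹ * (w * ∮ ζ in C(0, ρ), l ζ / (1 - w * ζ)),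
    ?_, by simp, ?_⟩
  · intro w hw
    have hΩ : IsOpen {p : ℂ × ℂ | p.2 ∈ ball (0 : ℂ) r₁ \ closedBall 0 r₀ ∧ 1 - p.1 * p.2 ≠ 0} :=
      (hA.preimage continuous_snd).inter (isOpen_ne_fun (by fun_prop) continuous_const)
    have hd : DifferentiableAt ℂ (fun w => ∮ ζ in C(0, ρ), l ζ / (1 - w * ζ)) w := by
      refine differentiableAt_circleIntegral_param (H := fun p : ℂ × ℂ => l p.2 / (1 - p.1 * p.2))
        (fun p hp => ?_) hΩ hρ.le fun ζ hζ => ⟨hsph ρ le_rfl hρr.le hζ, ?_⟩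
      · have h1 : DifferentiableAt ℂ l p.2 := hl.differentiableAt (hA.mem_nhds hp.1)
        have h2 : DifferentiableAt ℂ (fun p : ℂ × ℂ => l p.2) p := h1.comp p differentiableAt_snd
        simp only [div_eq_mul_inv]
        exact (h2.mul (DifferentiableAt.inv (by fun_prop) hp.2)).differentiableWithinAt
      · intro h
        rw [mem_sphere_zero_iff_norm] at hζ
        rw [mem_ball_zero_iff] at hw
        have h1 : ‖w * ζ‖ = 1 := by rw [← sub_eq_zero.mp h, norm_one]
        rw [norm_mul, hζ] at h1
        have := mul_lt_mul_of_pos_right hw hρ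
        rw [h1, inv_mul_cancel₀ hρ.ne'] at this
        exact lt_irrefl _ this
    exact ((differentiableAt_id.mul hd).const_mul _).differentiableWithinAt
  · intro z hz1 hz2
    have hzA : z ∈ ball (0 : ℂ) r₁ \ closedBall 0 r₀ :=
      hsph ‖z‖ hz1.le hz2.le (mem_sphere_zero_iff_norm.2 rfl)
    have hz0 : z ≠ 0 := norm_pos_iff.mp (hρ.trans hz1)
    have hds : DifferentiableOn ℂ (dslope l z) (ball 0 r₁ \ closedBall 0 r₀) :=
      (Complex.differentiableOn_dslope (hA.mem_nhds hzA)).2 hl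
    have hsub : closedBall (0 : ℂ) r \ ball 0 ρ ⊆ ball 0 r₁ \ closedBall 0 r₀ := by
      intro ζ hζ
      simp only [mem_sdiff, mem_ball_zero_iff, mem_closedBall_zero_iff, not_le, not_lt] at hζ ⊢
      constructor <;> linarith [hζ.1, hζ.2]
    have hcauchy := Complex.circleIntegral_eq_of_differentiable_on_annulus_off_countable hρ hρr.le
      countable_empty (hds.continuousOn.mono hsub) (fun ζ hζ => hds.differentiableAt
        (hA.mem_nhds (hsub ⟨ball_subset_closedBall hζ.1.1,
          fun h => hζ.1.2 (ball_subset_closedBall h)⟩)))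
    have hsplit : ∀ s, ρ ≤ s → s ≤ r → s ≠ ‖z‖ → (∮ ζ in C(0, s), dslope l z ζ) =
        (∮ ζ in C(0, s), l ζ / (ζ - z)) - l z * ∮ ζ in C(0, s), (ζ - z)⁻¹ := by
      intro s h1 h2 hne
      have hs : 0 ≤ s := hρ.le.trans h1
      have hnez : ∀ ζ ∈ sphere (0 : ℂ) s, ζ - z ≠ 0 := by
        intro ζ hζ h
        rw [mem_sphere_zero_iff_norm, sub_eq_zero.mp h] at hζ
        exact hne hζ.symm
      have hinv : ContinuousOn (fun ζ => (ζ - z)⁻¹) (sphere (0 : ℂ) s) :=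
        ContinuousOn.inv₀ (by fun_prop) hnez
      have hquot : ContinuousOn (fun ζ => l ζ / (ζ - z)) (sphere (0 : ℂ) s) :=
        (hl.continuousOn.mono (hsph s h1 h2)).div (by fun_prop) hnez
      rw [← circleIntegral.integral_const_mul, ← circleIntegral.integral_sub
        (hquot.circleIntegrable hs) ((hinv.const_mul (l z)).circleIntegrable hs)]
      refine circleIntegral.integral_congr hs fun ζ hζ => ?_
      rw [dslope_of_ne _ (sub_ne_zero.mp (hnez ζ hζ)), slope_def_field]
      ring
    rw [hsplit r hρr.le le_rfl hz2.ne', hsplit ρ le_rfl hρr.le hz1.ne,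
      circleIntegral.integral_sub_inv_of_mem_ball (mem_ball_zero_iff.2 hz2)] at hcauchy
    have hzero : (∮ ζ in C(0, ρ), (ζ - z)⁻¹) = 0 := by
      refine Complex.circleIntegral_eq_zero_of_differentiable_on_off_countable hρ.le
        countable_empty ?_ ?_
      · refine ContinuousOn.inv₀ (by fun_prop) fun ζ hζ h => ?_
        rw [mem_closedBall_zero_iff, sub_eq_zero.mp h] at hζ
        linarith
      · refine fun ζ hζ => DifferentiableAt.inv (by fun_prop) fun h => ?_
        have := mem_ball_zero_iff.mp hζ.1
        rw [sub_eq_zero.mp h] at this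
        linarith
    have hneg : z⁻¹ * (∮ ζ in C(0, ρ), l ζ / (1 - z⁻¹ * ζ)) =
        -∮ ζ in C(0, ρ), l ζ / (ζ - z) := by
      rw [← circleIntegral.integral_const_mul, ← neg_one_mul (∮ ζ in C(0, ρ), l ζ / (ζ - z)),
        ← circleIntegral.integral_const_mul]
      refine circleIntegral.integral_congr hρ.le fun ζ hζ => ?_
      have h1 : ζ - z ≠ 0 := by
        intro h
        rw [mem_sphere_zero_iff_norm, sub_eq_zero.mp h] at hζ
        exact hz1.ne hζ.symm
      have h2 : 1 - z⁻¹ * ζ = -(z⁻¹ * (ζ - z)) := by field_simp; ring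
      simp only [h2]
      field_simp
    rw [hzero, mul_zero, sub_zero] at hcauchy
    have hpi : (2 * Real.pi * Complex.I : ℂ) ≠ 0 := Complex.two_pi_I_ne_zero
    simp only [hneg, ← hcauchy]
    field_simp
    ring

/-- Taylor expansion of a holomorphic function on a disc, with holomorphic remainder. -/
theorem exists_polynomial_add_pow_mul {p : ℂ → ℂ} {r : ℝ} (hr : 0 < r)
    (hp : DifferentiableOn ℂ p (ball 0 r)) (k : ℕ) :
    ∃ (P : Polynomial ℂ) (q : ℂ → ℂ), P.degree < k ∧ DifferentiableOn ℂ q (ball 0 r) ∧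
      ∀ z, p z = P.eval z + z ^ k * q z := by
  induction k with
  | zero => exact ⟨0, p, by simp, hp, by simp⟩
  | succ k ih =>
    obtain ⟨P, q, hP, hq, hpq⟩ := ih
    refine ⟨P + Polynomial.C (q 0) * Polynomial.X ^ k, dslope q 0, ?_,
      (Complex.differentiableOn_dslope (ball_mem_nhds 0 hr)).2 hq, fun z => ?_⟩
    · refine (Polynomial.degree_add_le _ _).trans_lt (max_lt (hP.trans ?_) ?_)
      · exact_mod_cast Nat.lt_succ_self k
      · exact (Polynomial.degree_C_mul_X_pow_le k _).trans_lt (by exact_mod_cast Nat.lt_succ_self k)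
    · have h := sub_smul_dslope q 0 z
      rw [sub_zero, smul_eq_mul] at h
      simp only [Polynomial.eval_add, Polynomial.eval_mul, Polynomial.eval_C, Polynomial.eval_pow,
        Polynomial.eval_X, hpq z, pow_succ, mul_assoc, h]
      ring

open Filter Topology in
/-- A holomorphic function on a disc which extends meromorphically to the Riemann sphere, with a
pole of order at most `k` at infinity, is a polynomial of degree at most `k`. -/
theorem exists_polynomial_of_eq_pow_mul_inv {p h : ℂ → ℂ} {ρ r : ℝ} (hρ : 0 < ρ) (hρr : ρ < r)
    (hp : DifferentiableOn ℂ p (ball 0 r)) (hh : DifferentiableOn ℂ h (ball 0 ρ⁻¹)) (k : ℕ)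
    (heq : ∀ z : ℂ, ρ < ‖z‖ → ‖z‖ < r → p z = z ^ k * h z⁻¹) :
    ∃ P : Polynomial ℂ, P.degree < k ∧ ∀ z ∈ ball (0 : ℂ) r, p z = P.eval z + z ^ k * h 0 := by
  obtain ⟨P, q, hP, hq, hpq⟩ := exists_polynomial_add_pow_mul (hρ.trans hρr) hp k
  refine ⟨P, hP, fun z hz => ?_⟩
  set g : ℂ → ℂ := fun w => h w - (P.reflect k).eval w with hg
  have hg0 : g 0 = h 0 := by
    have : (P.reflect k).coeff 0 = 0 := by
      rw [Polynomial.coeff_reflect, Polynomial.revAt_le (Nat.zero_le k)]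
      exact Polynomial.coeff_eq_zero_of_degree_lt (by simpa using hP)
    rw [hg]
    simp only [← Polynomial.coeff_zero_eq_eval_zero, this, sub_zero]
  have hgd : DifferentiableOn ℂ g (ball 0 ρ⁻¹) := hh.sub (P.reflect k).differentiable.differentiableOn
  have hqg : ∀ z : ℂ, ρ < ‖z‖ → ‖z‖ < r → q z = g z⁻¹ := by
    intro z h1 h2
    have hz0 : z ≠ 0 := norm_pos_iff.mp (hρ.trans h1)
    let _ := invertibleOfNonzero hz0
    have hrefl := Polynomial.eval₂_reflect_mul_pow (RingHom.id ℂ) z k P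
      (Polynomial.natDegree_le_of_degree_le hP.le)
    rw [invOf_eq_inv] at hrefl
    simp only [Polynomial.eval₂_id] at hrefl
    have h3 := heq z h1 h2
    rw [hpq z, ← hrefl] at h3
    refine mul_left_cancel₀ (pow_ne_zero k hz0) ?_
    simp only [hg]
    linear_combination h3
  set e : ℂ → ℂ := fun z => if ‖z‖ < r then q z else g z⁻¹ with he
  have hinv : ∀ z : ℂ, ρ < ‖z‖ → z⁻¹ ∈ ball (0 : ℂ) ρ⁻¹ := by
    intro z h1
    rw [mem_ball_zero_iff, norm_inv]
    exact inv_strictAnti₀ hρ h1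
  have heg : ∀ z : ℂ, ρ < ‖z‖ → e z = g z⁻¹ := by
    intro z h1
    by_cases h2 : ‖z‖ < r
    · simp only [he, if_pos h2, hqg z h1 h2]
    · simp only [he, if_neg h2]
  have hed : Differentiable ℂ e := by
    intro z
    by_cases h2 : ‖z‖ < r
    · have hmem : ball (0 : ℂ) r ∈ 𝓝 z := isOpen_ball.mem_nhds (mem_ball_zero_iff.2 h2)
      refine (hq.differentiableAt hmem).congr_of_eventuallyEq (eventually_of_mem hmem fun y hy => ?_)
      simp only [he, if_pos (mem_ball_zero_iff.mp hy)]
    · have h1 : ρ < ‖z‖ := hρr.trans_le (not_lt.mp h2)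
      have hz0 : z ≠ 0 := norm_pos_iff.mp (hρ.trans h1)
      have hd : DifferentiableAt ℂ (fun z => g z⁻¹) z :=
        (hgd.differentiableAt (isOpen_ball.mem_nhds (hinv z h1))).comp z (differentiableAt_inv hz0)
      refine hd.congr_of_eventuallyEq ?_
      filter_upwards [(isOpen_lt continuous_const continuous_norm).mem_nhds h1] with y hy
      exact heg y hy
  have hlim : Tendsto e (cocompact ℂ) (𝓝 (h 0)) := by
    have h1 : Tendsto (fun z => g z⁻¹) (cocompact ℂ) (𝓝 (g 0)) := by
      have hc : ContinuousAt g 0 := (hgd.differentiableAt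
        (ball_mem_nhds 0 (inv_pos.2 hρ))).continuousAt
      refine hc.tendsto.comp ?_
      rw [← Metric.cobounded_eq_cocompact]
      exact tendsto_inv₀_cobounded
    rw [← hg0]
    refine h1.congr' ?_
    filter_upwards [(tendsto_norm_cocompact_atTop (E := ℂ)).eventually_gt_atTop ρ] with z hz
    exact (heg z hz).symm
  have := hed.apply_eq_of_tendsto_cocompact z hlim
  simp only [he, if_pos (mem_ball_zero_iff.mp hz)] at this
  rw [hpq z, this]

/-- A holomorphic family of monic polynomials of degree `k` on a disc has coefficients depending
holomorphically on the parameter. -/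
theorem exists_differentiableOn_coeff {E : Type*} [NormedAddCommGroup E] [NormedSpace ℂ E]
    {p : E → ℂ → ℂ} {s : Set E} {r : ℝ} (hr : 0 < r) {k : ℕ}
    (hp : ∀ z ∈ ball (0 : ℂ) r, DifferentiableOn ℂ (fun x => p x z) s)
    (hpoly : ∀ x ∈ s, ∃ P : Polynomial ℂ, P.degree < k ∧
      ∀ z ∈ ball (0 : ℂ) r, p x z = P.eval z + z ^ k) :
    ∃ c : Fin k → E → ℂ, (∀ j, DifferentiableOn ℂ (c j) s) ∧
      (∀ x, (∀ z ∈ ball (0 : ℂ) r, p x z = z ^ k) → ∀ j, c j x = 0) ∧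
      ∀ x ∈ s, ∀ z ∈ ball (0 : ℂ) r,
        p x z = z ^ k + ∑ j : Fin k, c j x * z ^ (k - 1 - (j : ℕ)) := by
  set v : Fin k → ℂ := fun i => ((r * ((i : ℕ) / k : ℝ) : ℝ) : ℂ) with hv
  have hk : ∀ _ : Fin k, (0 : ℝ) < k := fun i => by exact_mod_cast i.pos
  have hvr : ∀ i, v i ∈ ball (0 : ℂ) r := by
    intro i
    have h1 : ((i : ℕ) / k : ℝ) < 1 := (div_lt_one (hk i)).2 (by exact_mod_cast i.is_lt)
    have h2 : (0 : ℝ) ≤ (i : ℕ) / k := by positivity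
    rw [mem_ball_zero_iff, hv, Complex.norm_real, Real.norm_of_nonneg (by positivity)]
    exact mul_lt_of_lt_one_right hr h1
  have hvi : Function.Injective v := by
    intro i j hij
    have h1 : r * ((i : ℕ) / k : ℝ) = r * ((j : ℕ) / k : ℝ) := Complex.ofReal_injective hij
    have h2 := mul_left_cancel₀ hr.ne' h1
    rw [div_left_inj' (hk i).ne'] at h2
    exact Fin.ext (by exact_mod_cast h2)
  refine ⟨fun j x => ∑ i, (p x (v i) - v i ^ k) *
    (Lagrange.basis Finset.univ v i).coeff (k - 1 - j), fun j => ?_, fun x hx j => ?_,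
    fun x hx z hz => ?_⟩
  · exact DifferentiableOn.fun_sum fun i _ => ((hp _ (hvr i)).sub_const _).mul_const _
  · exact Finset.sum_eq_zero fun i _ => by rw [hx _ (hvr i), sub_self, zero_mul]
  · obtain ⟨P, hP, hPe⟩ := hpoly x hx
    have hint := Lagrange.eq_interpolate_of_eval_eq (s := Finset.univ) (v := v) (f := P)
      (fun i => p x (v i) - v i ^ k) hvi.injOn (by simpa using hP)
      (fun i _ => by rw [hPe _ (hvr i), add_sub_cancel_right])
    have hcoeff : ∀ n, P.coeff n =
        ∑ i, (p x (v i) - v i ^ k) * (Lagrange.basis Finset.univ v i).coeff n := by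
      intro n
      conv_lhs => rw [hint, Lagrange.interpolate_apply, Polynomial.finsetSum_coeff]
      simp only [Polynomial.coeff_C_mul]
    simp only [← hcoeff]
    rw [hPe z hz, add_comm, Fin.sum_univ_eq_sum_range
      (fun j => P.coeff (k - 1 - j) * z ^ (k - 1 - j)) k,
      Finset.sum_range_reflect (fun j => P.coeff j * z ^ j) k, P.eval_eq_sum,
      P.sum_over_range' (by simp) (max k (P.natDegree + 1)) (by simp)]
    congr 1
    refine (Finset.sum_subset (by simp) fun n _ hn => ?_).symm
    rw [P.coeff_eq_zero_of_degree_lt (hP.trans_le (by simpa using hn)), zero_mul]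

open Filter Topology in
/-- **Weierstrass preparation theorem** for a holomorphic function on a product of a complex
normed space with `ℂ`, regular in the last variable. -/
theorem weierstrass_preparation_prod {E : Type*} [NormedAddCommGroup E] [NormedSpace ℂ E]
    {F : E × ℂ → ℂ} {Ω : Set (E × ℂ)} (hΩ : IsOpen Ω) (h0Ω : (0, 0) ∈ Ω)
    (hF : DifferentiableOn ℂ F Ω) (hF0 : F (0, 0) = 0)
    (hreg : ¬ ∀ᶠ z in 𝓝 (0 : ℂ), F (0, z) = 0) :
    ∃ k : ℕ, 1 ≤ k ∧ ∃ δ > 0, ∃ r > 0, ∃ (c : Fin k → E → ℂ) (Φ : E × ℂ → ℂ),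
      (∀ j, DifferentiableOn ℂ (c j) (ball 0 δ) ∧ c j 0 = 0) ∧
      DifferentiableOn ℂ Φ (ball 0 δ ×ˢ ball 0 r) ∧ (∀ q ∈ ball 0 δ ×ˢ ball 0 r, Φ q ≠ 0) ∧
      ∀ x ∈ ball (0 : E) δ, ∀ z ∈ ball (0 : ℂ) r,
        F (x, z) = (z ^ k + ∑ j : Fin k, c j x * z ^ (k - 1 - (j : ℕ))) * Φ (x, z) := by
  have hslice : IsOpen {z : ℂ | ((0 : E), z) ∈ Ω} := hΩ.preimage (by fun_prop)
  have hF0d : DifferentiableOn ℂ (fun z => F (0, z)) {z : ℂ | ((0 : E), z) ∈ Ω} :=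
    hF.comp (by fun_prop) fun z hz => hz
  obtain ⟨k, u, hu, hu0, hFu⟩ :=
    (hF0d.analyticAt (hslice.mem_nhds h0Ω)).exists_eventuallyEq_pow_smul_nonzero_iff.2 hreg
  have hk : 1 ≤ k := by
    rw [Nat.one_le_iff_ne_zero]
    rintro rfl
    have := hFu.self_of_nhds
    simp only [hF0, pow_zero, one_smul] at this
    exact hu0 this.symm
  obtain ⟨R, hR, hball⟩ := Metric.eventually_nhds_iff_ball.mp
    ((hslice.eventually_mem h0Ω).and ((hu.continuousAt.eventually_ne hu0).and
      (hu.eventually_analyticAt.and hFu)))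
  obtain ⟨s, hs, rfl⟩ : ∃ s, 0 < s ∧ R = 5 * s := ⟨R / 5, by positivity, by ring⟩
  have hud : ∀ q : E × ℂ, q.2 ∈ ball (0 : ℂ) (5 * s) →
      DifferentiableAt ℂ (fun q : E × ℂ => u q.2) q := fun q hq =>
    (hball _ hq).2.2.1.differentiableAt.comp q differentiableAt_snd
  set D : Set (E × ℂ) := {q | q ∈ Ω ∧ q.2 ∈ ball (0 : ℂ) (5 * s) ∧ q.2 ≠ 0} with hD
  have hDo : IsOpen D := hΩ.inter ((isOpen_ball.preimage continuous_snd).inter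
    (isOpen_ne_fun continuous_snd continuous_const))
  set G : E × ℂ → ℂ := fun q => F q * (q.2 ^ k * u q.2)⁻¹ with hG
  have hne : ∀ q ∈ D, q.2 ^ k * u q.2 ≠ 0 := fun q hq =>
    mul_ne_zero (pow_ne_zero k hq.2.2) (hball _ hq.2.1).2.1
  have hGd : DifferentiableOn ℂ G D := fun q hq => by
    refine DifferentiableAt.differentiableWithinAt ?_
    exact (hF.differentiableAt (hΩ.mem_nhds hq.1)).mul
      (((differentiableAt_snd.pow k).mul (hud q hq.2.1)).inv (hne q hq))
  have hG0 : ∀ z : ℂ, z ∈ ball (0 : ℂ) (5 * s) → z ≠ 0 → ((0 : E), z) ∈ D ∧ G (0, z) = 1 := by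
    intro z hz hz0
    have hmem : ((0 : E), z) ∈ D := ⟨(hball z hz).1, hz, hz0⟩
    refine ⟨hmem, ?_⟩
    have h1 := (hball z hz).2.2.2
    simp only [sub_zero, smul_eq_mul] at h1
    simp only [hG, h1]
    exact mul_inv_cancel₀ (hne _ hmem)
  set D' : Set (E × ℂ) := D ∩ G ⁻¹' ball 1 1 with hD'
  have hD'o : IsOpen D' := hGd.continuousOn.isOpen_inter_preimage hDo isOpen_ball
  set l : E × ℂ → ℂ := fun q => Complex.log (G q) with hl
  have hslit : ∀ q ∈ D', G q ∈ Complex.slitPlane := fun q hq =>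
    Complex.ball_one_subset_slitPlane hq.2
  have hld : DifferentiableOn ℂ l D' := fun q hq =>
    ((hGd.mono inter_subset_left) q hq).clog (hslit q hq)
  obtain ⟨δ, hδ, hδΩ, hδD⟩ : ∃ δ > 0,
      (∀ x ∈ ball (0 : E) δ, ∀ z ∈ closedBall (0 : ℂ) (4 * s), (x, z) ∈ Ω) ∧
      ∀ x ∈ ball (0 : E) δ, ∀ z ∈ closedBall (0 : ℂ) (4 * s) \ ball 0 s, (x, z) ∈ D' := by
    have hcb : closedBall (0 : ℂ) (4 * s) ⊆ ball 0 (5 * s) :=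
      closedBall_subset_ball (by linarith)
    obtain ⟨u₁, v₁, hu₁, -, h0u₁, hv₁, huv₁⟩ := generalized_tube_lemma
      (isCompact_singleton (x := (0 : E))) (isCompact_closedBall (0 : ℂ) (4 * s)) hΩ (by
        rintro ⟨x, z⟩ ⟨rfl, hz⟩
        exact (hball z (hcb hz)).1)
    obtain ⟨u₂, v₂, hu₂, -, h0u₂, hv₂, huv₂⟩ := generalized_tube_lemma
      (isCompact_singleton (x := (0 : E)))
      ((isCompact_closedBall (0 : ℂ) (4 * s)).diff (isOpen_ball (x := (0 : ℂ)) (ε := s))) hD'o (by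
        rintro ⟨x, z⟩ ⟨rfl, hz⟩
        have h1 := hG0 z (hcb hz.1) (by rintro rfl; exact hz.2 (mem_ball_self hs))
        exact ⟨h1.1, by rw [mem_preimage, h1.2]; exact mem_ball_self one_pos⟩)
    obtain ⟨δ, hδ, hsub⟩ := Metric.isOpen_iff.mp (hu₁.inter hu₂) 0 ⟨h0u₁ rfl, h0u₂ rfl⟩
    exact ⟨δ, hδ, fun x hx z hz => huv₁ ⟨(hsub hx).1, hv₁ hz⟩,
      fun x hx z hz => huv₂ ⟨(hsub hx).2, hv₂ hz⟩⟩
  have hsphD : ∀ x ∈ ball (0 : E) δ, ∀ ζ ∈ sphere (0 : ℂ) (3 * s), (x, ζ) ∈ D' := by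
    intro x hx ζ hζ
    rw [mem_sphere_zero_iff_norm] at hζ
    refine hδD x hx ζ ⟨?_, ?_⟩
    · rw [mem_closedBall_zero_iff]; linarith
    · rw [mem_ball_zero_iff]; linarith
  set L : E × ℂ → ℂ := fun q => (2 * Real.pi * Complex.I)⁻¹ *
    ∮ ζ in C(0, 3 * s), l (q.1, ζ) / (ζ - q.2) with hL
  have hLd : ∀ q ∈ ball (0 : E) δ ×ˢ ball (0 : ℂ) (3 * s), DifferentiableAt ℂ L q := by
    rintro ⟨x, z⟩ ⟨hx, hz⟩
    have hΩ' : IsOpen {w : (E × ℂ) × ℂ | (w.1.1, w.2) ∈ D' ∧ w.2 - w.1.2 ≠ 0} :=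
      (hD'o.preimage (by fun_prop)).inter (isOpen_ne_fun (by fun_prop) continuous_const)
    refine (differentiableAt_circleIntegral_param
      (H := fun w : (E × ℂ) × ℂ => l (w.1.1, w.2) / (w.2 - w.1.2))
      (fun w hw => ?_) hΩ' (by positivity) fun ζ hζ => ⟨hsphD x hx ζ hζ, ?_⟩).const_mul _
    · have h1 : DifferentiableAt ℂ l (w.1.1, w.2) := hld.differentiableAt (hD'o.mem_nhds hw.1)
      have h2 : DifferentiableAt ℂ (fun w : (E × ℂ) × ℂ => l (w.1.1, w.2)) w :=
        h1.comp (f := fun w : (E × ℂ) × ℂ => (w.1.1, w.2)) w (by fun_prop)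
      simp only [div_eq_mul_inv]
      exact (h2.mul (DifferentiableAt.inv (by fun_prop) hw.2)).differentiableWithinAt
    · intro h
      have hζz : ζ = z := sub_eq_zero.mp h
      rw [mem_sphere_zero_iff_norm, hζz] at hζ
      exact (mem_ball_zero_iff.mp hz).ne hζ
  set Φ : E × ℂ → ℂ := fun q => u q.2 * Complex.exp (L q) with hΦ
  have h35 : ball (0 : ℂ) (3 * s) ⊆ ball 0 (5 * s) := ball_subset_ball (by linarith)
  have hΦd : ∀ q ∈ ball (0 : E) δ ×ˢ ball (0 : ℂ) (3 * s), DifferentiableAt ℂ Φ q := fun q hq =>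
    (hud q (h35 hq.2)).mul (hLd q hq).cexp
  have hΦ0 : ∀ q ∈ ball (0 : E) δ ×ˢ ball (0 : ℂ) (3 * s), Φ q ≠ 0 := fun q hq =>
    mul_ne_zero (hball _ (h35 hq.2)).2.1 (Complex.exp_ne_zero _)
  set p : E → ℂ → ℂ := fun x z => F (x, z) * (Φ (x, z))⁻¹ with hp
  have hpd : ∀ x ∈ ball (0 : E) δ, ∀ z ∈ ball (0 : ℂ) (3 * s),
      DifferentiableAt ℂ (fun q : E × ℂ => F q * (Φ q)⁻¹) (x, z) := by
    intro x hx z hz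
    exact (hF.differentiableAt (hΩ.mem_nhds (hδΩ x hx z
      (ball_subset_closedBall (ball_subset_ball (by linarith) hz))))).mul
        ((hΦd (x, z) ⟨hx, hz⟩).inv (hΦ0 (x, z) ⟨hx, hz⟩))
  have hpoly : ∀ x ∈ ball (0 : E) δ, ∃ P : Polynomial ℂ, P.degree < k ∧
      ∀ z ∈ ball (0 : ℂ) (3 * s), p x z = P.eval z + z ^ k := by
    intro x hx
    obtain ⟨g, hgd, hg0, hg⟩ := exists_laurent_splitting (l := fun z => l (x, z)) (r₀ := s)
      (ρ := 2 * s) (r := 3 * s) (r₁ := 4 * s) hs (by linarith) (by linarith) (by linarith)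
      (hld.comp (f := fun z => (x, z)) (by fun_prop) fun z hz => hδD x hx z
        ⟨ball_subset_closedBall hz.1, fun h => hz.2 (ball_subset_closedBall h)⟩)
    have hres := exists_polynomial_of_eq_pow_mul_inv (p := p x)
      (h := fun w => Complex.exp (g w)) (ρ := 2 * s) (r := 3 * s) (by positivity) (by linarith)
      (fun z hz => ((hpd x hx z hz).comp (f := fun z => (x, z)) z
        (by fun_prop)).differentiableWithinAt) hgd.cexp k (by
        intro z h1 h2
        have hzD : (x, z) ∈ D' := by
          refine hδD x hx z ⟨?_, ?_⟩
          · rw [mem_closedBall_zero_iff]; linarith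
          · rw [mem_ball_zero_iff]; linarith
        have h3 : G (x, z) = Complex.exp (L (x, z)) * Complex.exp (g z⁻¹) := by
          rw [← Complex.exp_add, ← hg z h1 h2]
          exact (Complex.exp_log (Complex.slitPlane_ne_zero (hslit _ hzD))).symm
        have h4 : F (x, z) = z ^ k * u z * G (x, z) := by
          have h5 : z ^ k * u z ≠ 0 := hne _ hzD.1
          simp only [hG]
          rw [mul_comm, inv_mul_cancel_right₀ h5]
        have h5 : u z ≠ 0 := (hball z hzD.1.2.1).2.1
        have h6 := Complex.exp_ne_zero (L (x, z))
        simp only [hp, hΦ, h4, h3]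
        field_simp)
    simpa [hg0] using hres
  have hpz : ∀ z ∈ ball (0 : ℂ) (3 * s), p 0 z = z ^ k := by
    intro z hz
    have hL0 : L (0, z) = 0 := by
      have : (∮ ζ in C(0, 3 * s), l (0, ζ) / (ζ - z)) = ∮ ζ in C(0, 3 * s), (0 : ℂ) := by
        refine circleIntegral.integral_congr (by positivity) fun ζ hζ => ?_
        have h1 := hsphD 0 (mem_ball_self hδ) ζ hζ
        simp only [hl, (hG0 ζ h1.1.2.1 h1.1.2.2).2, Complex.log_one, zero_div]
      simp only [hL]
      rw [this]
      simp [circleIntegral]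
    have h1 := (hball z (h35 hz)).2.2.2
    simp only [sub_zero, smul_eq_mul] at h1
    simp only [hp, hΦ, hL0, h1, Complex.exp_zero, mul_one]
    exact mul_inv_cancel_right₀ (hball z (h35 hz)).2.1 _
  obtain ⟨c, hcd, hc0, hc⟩ := exists_differentiableOn_coeff (p := p) (s := ball (0 : E) δ)
    (r := 3 * s) (by positivity) (fun z hz x hx => ((hpd x hx z hz).comp (f := fun x => (x, z)) x
      (by fun_prop)).differentiableWithinAt) hpoly
  refine ⟨k, hk, δ, hδ, 3 * s, by positivity, c, Φ, fun j => ⟨hcd j, hc0 0 hpz j⟩,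
    fun q hq => (hΦd q hq).differentiableWithinAt, hΦ0, fun x hx z hz => ?_⟩
  rw [← hc x hx z hz]
  exact (inv_mul_cancel_right₀ (hΦ0 (x, z) ⟨hx, hz⟩) _).symm

open Filter Topology in
/-- A holomorphic function which does not vanish identically near `a` does not vanish identically
near `a` on some line through `a`. -/
theorem exists_not_eventually_zero_on_line {E : Type*} [NormedAddCommGroup E] [NormedSpace ℂ E]
    {f : E → ℂ} {U : Set E} (hU : IsOpen U) {a : E} (haU : a ∈ U) (hf : DifferentiableOn ℂ f U)
    (hnz : ¬ ∀ᶠ z in 𝓝 a, f z = 0) :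
    ∃ v : E, ¬ ∀ᶠ t in 𝓝 (0 : ℂ), f (t • v + a) = 0 := by
  obtain ⟨ε, hε, hεU⟩ := Metric.isOpen_iff.mp hU a haU
  obtain ⟨b, hb, hfb⟩ : ∃ b ∈ ball a ε, f b ≠ 0 := by
    by_contra! h
    exact hnz (eventually_of_mem (ball_mem_nhds a hε) h)
  refine ⟨b - a, fun hz => hfb ?_⟩
  set γ : ℂ → E := fun t => t • (b - a) + a with hγ
  have hγd : Differentiable ℂ γ := by fun_prop
  set S : Set ℂ := γ ⁻¹' ball a ε with hS
  have hSo : IsOpen S := isOpen_ball.preimage hγd.continuous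
  have hSc : Convex ℝ S := by
    intro t ht t' ht' x y hx hy hxy
    have h1 : γ (x • t + y • t') = x • γ t + y • γ t' := by
      simp only [hγ, add_smul, smul_add, smul_assoc]
      rw [add_add_add_comm, ← add_smul x y a, hxy, one_smul]
    rw [hS, mem_preimage, h1]
    exact convex_ball a ε ht ht' hx hy hxy
  have h0 : (0 : ℂ) ∈ S := by simpa [hS, hγ] using hε
  have h1 : (1 : ℂ) ∈ S := by simpa [hS, hγ] using hb
  have han : AnalyticOnNhd ℂ (f ∘ γ) S :=
    (hf.comp hγd.differentiableOn fun t ht => hεU ht).analyticOnNhd hSo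
  simpa [hγ] using han.eqOn_zero_of_preconnected_of_eventuallyEq_zero hSc.isPreconnected h0 hz h1

/- STATEMENT 5: Weierstrass preparation theorem in ℓ².  Near a zero `a` of a
holomorphic function `f ≢ 0` one can split ℓ² = E' ⊕ ℂv (with E' = (ℂv)ᗮ)
and factor f(z+a) = (λ^k + Σ_{j=1}^k c_j(z') λ^{k-j})·φ(z) for z = z' + λv,
with c_j holomorphic, c_j(0) = 0, and φ holomorphic nonvanishing. -/

theorem weierstrass_preparation_ellTwo
    (f : EllTwo → ℂ) (U : Set EllTwo) (hU : IsOpen U) (a : EllTwo) (haU : a ∈ U)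
    (hf : DifferentiableOn ℂ f U) (hfa : f a = 0)
    (hnz : ¬ (∀ᶠ z in nhds a, f z = 0)) :
    ∃ v : EllTwo, v ≠ 0 ∧ ∃ k : ℕ, 1 ≤ k ∧
      ∃ (W : Set EllTwo) (c : Fin k → EllTwo → ℂ) (φ : EllTwo → ℂ),
        IsOpen W ∧ (0 : EllTwo) ∈ W ∧
        (∀ j, DifferentiableOn ℂ (c j) W ∧ c j 0 = 0) ∧
        DifferentiableOn ℂ φ W ∧ (∀ z ∈ W, φ z ≠ 0) ∧
        ∀ (z' : EllTwo) (lam : ℂ), z' ∈ ((ℂ ∙ v)ᗮ : Submodule ℂ EllTwo) →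
          z' + lam • v ∈ W →
            f (z' + lam • v + a) =
              (lam ^ k + ∑ j : Fin k, c j z' * lam ^ (k - 1 - (j : ℕ))) *
                φ (z' + lam • v) := by
  obtain ⟨v, hv⟩ := exists_not_eventually_zero_on_line hU haU hf hnz
  have hv0 : v ≠ 0 := by
    rintro rfl
    exact hv (by simp [hfa])
  have hline : Differentiable ℂ fun q : EllTwo × ℂ => q.1 + q.2 • v + a := by fun_prop
  obtain ⟨k, hk, δ, hδ, r, hr, c, Φ, hc, hΦ, hΦ0, hfac⟩ := weierstrass_preparation_prod
    (F := fun q : EllTwo × ℂ => f (q.1 + q.2 • v + a))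
    (hU.preimage hline.continuous) (by simpa using haU)
    (hf.comp hline.differentiableOn fun q hq => hq) (by simpa using hfa) (by simpa using hv)
  set π : EllTwo →L[ℂ] ℂ := (inner ℂ v v)⁻¹ • innerSL ℂ v with hπ
  have hπv : π v = 1 := by
    simp only [hπ, smul_apply, innerSL_apply_apply, smul_eq_mul]
    exact inv_mul_cancel₀ (inner_self_ne_zero.2 hv0)
  set σ : EllTwo → EllTwo × ℂ := fun z => (z - π z • v, π z) with hσ
  have hσd : Differentiable ℂ σ := by fun_prop
  have hσW : IsOpen (σ ⁻¹' (ball 0 δ ×ˢ ball 0 r)) :=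
    (isOpen_ball.prod isOpen_ball).preimage hσd.continuous
  refine ⟨v, hv0, k, hk, ball 0 δ ∩ σ ⁻¹' (ball 0 δ ×ˢ ball 0 r), c, Φ ∘ σ,
    isOpen_ball.inter hσW, ⟨mem_ball_self hδ, by simp [hσ, hδ, hr]⟩,
    fun j => ⟨(hc j).1.mono inter_subset_left, (hc j).2⟩,
    hΦ.comp hσd.differentiableOn fun z hz => hz.2, fun z hz => hΦ0 _ hz.2, ?_⟩
  intro z' lam hz' hW
  have hπz' : π z' = 0 := by
    simp [hπ, Submodule.mem_orthogonal_singleton_iff_inner_right.1 hz']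
  have hσz : σ (z' + lam • v) = (z', lam) := by
    simp [hσ, hπz', hπv]
  obtain ⟨-, hW⟩ := hW
  rw [mem_preimage, hσz] at hW
  rw [Function.comp_apply, hσz]
  exact hfac z' hW.1 lam hW.2
end
end

section
/- Let f and g be holomorphic functions on a neighbourhood of a point a in ℓ² whose germs at a are relatively prime in the local ring 𝒪_a of germs of holomorphic functions at a. Then there exists an open neighbourhood 𝒰 of a such that for every y ∈ 𝒰 the germs of f and g at y are relatively prime in 𝒪_y. -/
noncomputable section
open Set Metric

/- STATEMENT 6: relative primality of holomorphic germs is an open condition.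
Two holomorphic germs are relatively prime at `a` if they admit no common
non-invertible (i.e. vanishing at `a`) holomorphic factor near `a`. -/

/-- The germs at `a` of `f` and `g` are relatively prime: there is no
factorization `f = d·p`, `g = d·q` near `a` with `d`, `p`, `q` holomorphic
and `d` non-invertible at `a` (i.e. `d a = 0`). -/
def RelativelyPrimeAt (f g : EllTwo → ℂ) (a : EllTwo) : Prop :=
  ¬ ∃ (V : Set EllTwo) (d p q : EllTwo → ℂ), IsOpen V ∧ a ∈ V ∧
      DifferentiableOn ℂ d V ∧ DifferentiableOn ℂ p V ∧ DifferentiableOn ℂ q V ∧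
      d a = 0 ∧ ∀ z ∈ V, f z = d z * p z ∧ g z = d z * q z

/-- The Fréchet derivative of a holomorphic function on an open subset of a complex normed space is
continuous. -/
theorem continuousOn_fderiv_of_differentiableOn {E : Type*} [NormedAddCommGroup E]
    [NormedSpace ℂ E] {f : E → ℂ} {U : Set E} (hU : IsOpen U) (hf : DifferentiableOn ℂ f U) :
    ContinuousOn (fderiv ℂ f) U := by
  intro x hx
  have hcx : ContinuousAt f x := hf.continuousOn.continuousAt (hU.mem_nhds hx)
  have h1 : ∀ᶠ y in nhds x, y ∈ U ∧ dist (f y) (f x) < 1 :=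
    (hU.eventually_mem hx).and (hcx (ball_mem_nhds _ one_pos))
  obtain ⟨R, hR, hball⟩ := Metric.eventually_nhds_iff_ball.1 h1
  have hlip : ∀ w ∈ ball x (R / 2), ∀ w' ∈ ball w (R / 2),
      dist (f w') (f w) ≤ 2 / (R / 2) * dist w' w := by
    intro w hw w' hw'
    have hsub : ball w (R / 2) ⊆ ball x R := by
      apply ball_subset_ball'
      have := mem_ball.1 hw
      linarith
    refine Complex.dist_le_div_mul_dist_of_mapsTo_ball
      (hf.mono fun y hy => (hball y (hsub hy)).1) (fun y hy => ?_) hw'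
    have e1 := (hball y (hsub hy)).2
    have e2 := (hball w (hsub (mem_ball_self (by linarith)))).2
    have := dist_triangle_right (f y) (f w) (f x)
    simp only [mem_closedBall]
    linarith
  refine ContinuousAt.continuousWithinAt ?_
  rw [Metric.continuousAt_iff']
  intro ε hε
  have hK : 0 < 2 / (R / 2) := by positivity
  have hδ : 0 < min (R / 4) (ε * (R / 4) / (2 * (2 / (R / 2)) + 1)) := by positivity
  filter_upwards [ball_mem_nhds x hδ] with y hy
  have hy1 : dist y x < R / 4 := (mem_ball.1 hy).trans_le (min_le_left _ _)
  have hy2 : dist y x < ε * (R / 4) / (2 * (2 / (R / 2)) + 1) :=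
    (mem_ball.1 hy).trans_le (min_le_right _ _)
  have hyh : dist y x = ‖y - x‖ := dist_eq_norm _ _
  have hshift : ∀ w ∈ ball x (R / 4), w + (y - x) ∈ ball x R := by
    intro w hw
    have h3 := norm_add_le (w - x) (y - x)
    have h4 := mem_ball_iff_norm.1 hw
    rw [mem_ball_iff_norm]
    have : w + (y - x) - x = (w - x) + (y - x) := by abel
    rw [this]
    linarith
  have hd : DifferentiableOn ℂ (fun w => f (w + (y - x)) - f w) (ball x (R / 4)) := by
    refine DifferentiableOn.sub ?_ (hf.mono fun w hw => (hball w (ball_subset_ball (by linarith) hw)).1)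
    exact hf.comp (by fun_prop) fun w hw => (hball _ (hshift w hw)).1
  have hm : MapsTo (fun w => f (w + (y - x)) - f w) (ball x (R / 4))
      (closedBall ((fun w => f (w + (y - x)) - f w) x) (2 * (2 / (R / 2)) * dist y x)) := by
    have key : ∀ w ∈ ball x (R / 4), ‖f (w + (y - x)) - f w‖ ≤ 2 / (R / 2) * dist y x := by
      intro w hw
      have := hlip w (ball_subset_ball (by linarith) hw) (w + (y - x))
        (by rw [mem_ball_iff_norm]; simp; linarith)
      simpa [dist_eq_norm] using this
    intro w hw
    have k1 := key w hw
    have k2 := key x (mem_ball_self (by linarith))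
    rw [mem_closedBall, dist_eq_norm]
    refine (norm_sub_le _ _).trans ?_
    linarith
  have hb := Complex.norm_fderiv_le_div_of_mapsTo_ball hd hm (by linarith)
  have hdx : DifferentiableAt ℂ f x := hf.differentiableAt (hU.mem_nhds hx)
  have hyU : y ∈ U := (hball y (mem_ball.2 (by linarith))).1
  have hdy : DifferentiableAt ℂ f y := hf.differentiableAt (hU.mem_nhds hyU)
  have hfd : fderiv ℂ (fun w => f (w + (y - x)) - f w) x = fderiv ℂ f y - fderiv ℂ f x := by
    rw [fderiv_fun_sub _ hdx, fderiv_comp_add_right]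
    · simp
    · have : DifferentiableAt ℂ f (x + (y - x)) := by simpa using hdy
      exact this.comp x (by fun_prop)
  rw [hfd] at hb
  rw [dist_eq_norm]
  refine hb.trans_lt ?_
  rw [div_lt_iff₀ (by linarith)]
  rw [lt_div_iff₀ (by positivity)] at hy2
  nlinarith [dist_nonneg (x := y) (y := x)]

/-- A circle integral of a function that is jointly holomorphic in the parameter and in the
variable of integration depends holomorphically on the parameter. -/
theorem differentiableOn_circleIntegral_param {E : Type*} [NormedAddCommGroup E]
    [NormedSpace ℂ E] {G : E × ℂ → ℂ} {Ω : Set (E × ℂ)} (hΩ : IsOpen Ω)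
    (hG : DifferentiableOn ℂ G Ω) {r : ℝ} (hr : 0 ≤ r) {V : Set E}
    (hV : ∀ z ∈ V, ∀ s : ℂ, ‖s‖ = r → (z, s) ∈ Ω) :
    DifferentiableOn ℂ (fun z => ∮ s in C(0, r), G (z, s)) V := by
  intro x hx
  refine DifferentiableAt.differentiableWithinAt ?_
  have hcm : ∀ θ, ‖circleMap 0 r θ‖ = r := fun θ => by simp [abs_of_nonneg hr]
  have hcont := continuousOn_fderiv_of_differentiableOn hΩ hG
  have hfc : ContinuousOn (fun θ : ℝ => fderiv ℂ G (x, circleMap 0 r θ)) univ :=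
    hcont.comp (by fun_prop) fun θ _ => hV x hx _ (hcm θ)
  have hfc' : Continuous (fun θ : ℝ => fderiv ℂ G (x, circleMap 0 r θ)) :=
    continuousOn_univ.1 hfc
  obtain ⟨C, hC⟩ := (isCompact_sphere (0 : ℂ) r).exists_bound_of_continuousOn
    (f := fun s => fderiv ℂ G (x, s))
    (hcont.comp (by fun_prop) fun s hs => hV x hx s (by simpa using hs))
  have hopen : IsOpen (Ω ∩ (fun w => ‖fderiv ℂ G w‖) ⁻¹' Iio (C + 1)) :=
    hcont.norm.isOpen_inter_preimage hΩ isOpen_Iio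
  obtain ⟨v, w, hv, -, hxv, hsw, hvw⟩ := generalized_tube_lemma (isCompact_singleton (x := x))
    (isCompact_sphere (0 : ℂ) r) hopen (by
      rintro ⟨z, s⟩ ⟨hz, hs⟩
      obtain rfl : z = x := hz
      refine ⟨hV _ hx s (by simpa using hs), ?_⟩
      simpa using (hC s hs).trans_lt (lt_add_one C))
  have hvn : v ∈ nhds x := hv.mem_nhds (hxv rfl)
  have hmem : ∀ z ∈ v, ∀ θ, (z, circleMap 0 r θ) ∈ Ω ∩ (fun w => ‖fderiv ℂ G w‖) ⁻¹' Iio (C + 1) :=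
    fun z hz θ => hvw ⟨hz, hsw (by simpa using hcm θ)⟩
  have hcontF : ∀ z ∈ v, Continuous fun θ : ℝ => deriv (circleMap 0 r) θ • G (z, circleMap 0 r θ) := by
    intro z hz
    refine Continuous.smul ((contDiff_circleMap 0 r (n := 1)).continuous_deriv le_rfl) ?_
    exact continuousOn_univ.1 (hG.continuousOn.comp (by fun_prop) fun θ _ => (hmem z hz θ).1)
  have hderiv := intervalIntegral.hasFDerivAt_integral_of_dominated_of_fderiv_le (𝕜 := ℂ)
    (μ := MeasureTheory.volume) (a := 0) (b := 2 * Real.pi)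
    (F := fun z θ => deriv (circleMap 0 r) θ • G (z, circleMap 0 r θ))
    (F' := fun z θ => deriv (circleMap 0 r) θ •
      (fderiv ℂ G (z, circleMap 0 r θ)).comp (ContinuousLinearMap.inl ℂ E ℂ))
    (bound := fun _ => r * (C + 1)) (x₀ := x) (s := v) hvn ?_ ?_ ?_ ?_ ?_ ?_
  · exact hderiv.differentiableAt
  · filter_upwards [hvn] with z hz
    exact (hcontF z hz).aestronglyMeasurable
  · exact (hcontF x (mem_of_mem_nhds hvn)).intervalIntegrable _ _
  · refine Continuous.aestronglyMeasurable ?_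
    refine Continuous.smul ((contDiff_circleMap 0 r (n := 1)).continuous_deriv le_rfl) ?_
    exact hfc'.clm_comp continuous_const
  · refine Filter.Eventually.of_forall fun θ _ z hz => ?_
    rw [norm_smul]
    have h1 : ‖deriv (circleMap 0 r) θ‖ = r := by simp [deriv_circleMap, abs_of_nonneg hr]
    rw [h1]
    refine mul_le_mul_of_nonneg_left ?_ hr
    refine (ContinuousLinearMap.opNorm_comp_le _ _).trans ?_
    have h2 : ‖fderiv ℂ G (z, circleMap 0 r θ)‖ < C + 1 := (hmem z hz θ).2
    have h3 := ContinuousLinearMap.norm_inl_le_one ℂ E ℂ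
    calc _ ≤ ‖fderiv ℂ G (z, circleMap 0 r θ)‖ * 1 := by gcongr
      _ ≤ _ := by linarith
  · exact intervalIntegrable_const
  · refine Filter.Eventually.of_forall fun θ _ z hz => ?_
    have h1 : HasFDerivAt G (fderiv ℂ G (z, circleMap 0 r θ)) (z, circleMap 0 r θ) :=
      (hG.differentiableAt (hΩ.mem_nhds (hmem z hz θ).1)).hasFDerivAt
    have h2 : HasFDerivAt (fun z : E => (z, circleMap 0 r θ)) (ContinuousLinearMap.inl ℂ E ℂ) z :=
      hasFDerivAt_prodMk_left z _
    have h3 := h1.comp z h2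
    exact h3.const_smul (deriv (circleMap 0 r) θ)

theorem accPt_closedBall_complex {R : ℝ} (hR : 0 < R) {x : ℂ} (hx : x ∈ closedBall (0 : ℂ) R) :
    AccPt x (Filter.principal (closedBall (0 : ℂ) R)) := by
  refine (convex_closedBall (0 : ℂ) R).isPreconnected.preperfect_of_nontrivial ?_ x hx
  exact ⟨0, by simp [hR.le], (R : ℂ), by simp [abs_of_pos hR],
    fun h => hR.ne (by exact_mod_cast h)⟩

theorem meromorphicOrderAt_ne_top_of_analyticOnNhd_closedBall {f : ℂ → ℂ} {R : ℝ}
    (hf : AnalyticOnNhd ℂ f (closedBall 0 R)) {t₀ : ℂ} (ht₀ : t₀ ∈ closedBall (0 : ℂ) R)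
    (hft₀ : f t₀ ≠ 0) {x : ℂ} (hx : x ∈ closedBall (0 : ℂ) R) :
    meromorphicOrderAt f x ≠ ⊤ := by
  refine hf.meromorphicOn.meromorphicOrderAt_ne_top_of_isPreconnected
    (convex_closedBall (0 : ℂ) R).isPreconnected ht₀ hx ?_
  rw [(hf t₀ ht₀).meromorphicOrderAt_eq, (hf t₀ ht₀).analyticOrderAt_eq_zero.2 hft₀]
  simp

/-- Two analytic functions on a closed disc which agree on a codiscrete subset are equal. -/
theorem eqOn_closedBall_of_eventuallyEq_codiscreteWithin {f g : ℂ → ℂ} {R : ℝ} (hR : 0 < R)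
    (hf : AnalyticOnNhd ℂ f (closedBall 0 R)) (hg : AnalyticOnNhd ℂ g (closedBall 0 R))
    (h : f =ᶠ[Filter.codiscreteWithin (closedBall (0 : ℂ) R)] g) :
    EqOn f g (closedBall 0 R) := by
  intro x hx
  have h1 := mem_codiscreteWithin.1 h x hx
  rw [Filter.disjoint_principal_right] at h1
  have h2 : ∃ᶠ y in nhdsWithin x {x}ᶜ, y ∈ closedBall (0 : ℂ) R :=
    accPt_iff_frequently_nhdsNE.1 (accPt_closedBall_complex hR hx)
  have h3 : ∃ᶠ y in nhdsWithin x {x}ᶜ, f y = g y := by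
    refine (h2.and_eventually h1).mono ?_
    rintro y ⟨hy, hy'⟩
    by_contra hne
    exact hy' ⟨hy, hne⟩
  exact (((hf x hx).frequently_eq_iff_eventually_eq (hg x hx)).1 h3).self_of_nhds

/-- An analytic function on a closed disc which is not identically zero is the product of finitely
many linear factors and of a nowhere vanishing analytic function. -/
theorem exists_prod_sub_mul_of_analyticOnNhd_closedBall {f : ℂ → ℂ} {R : ℝ} (hR : 0 < R)
    (hf : AnalyticOnNhd ℂ f (closedBall 0 R)) {t₀ : ℂ} (ht₀ : t₀ ∈ closedBall (0 : ℂ) R)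
    (hft₀ : f t₀ ≠ 0) :
    ∃ (n : ℕ) (τ : Fin n → ℂ) (u : ℂ → ℂ), AnalyticOnNhd ℂ u (closedBall 0 R) ∧
      (∀ t ∈ closedBall (0 : ℂ) R, u t ≠ 0) ∧ (∀ i, τ i ∈ closedBall (0 : ℂ) R) ∧
      ∀ t ∈ closedBall (0 : ℂ) R, f t = (∏ i, (t - τ i)) * u t := by
  have hfin := (MeromorphicOn.divisor f (closedBall (0 : ℂ) R)).finiteSupport
    (isCompact_closedBall 0 R)
  obtain ⟨g, hg, hg0, hfg⟩ := hf.meromorphicOn.extract_zeros_poles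
    (fun u => meromorphicOrderAt_ne_top_of_analyticOnNhd_closedBall hf ht₀ hft₀ u.2) hfin
  set D := MeromorphicOn.divisor f (closedBall (0 : ℂ) R) with hD
  have hDnn : ∀ u, 0 ≤ D u := fun u => (MeromorphicOn.AnalyticOnNhd.divisor_nonneg hf) u
  let ι := Σ u : hfin.toFinset, Fin (D u).toNat
  have hprod : ∀ t : ℂ, (∏ᶠ u, (fun z : ℂ => z - u) ^ D u) t =
      ∏ j : Fin (Fintype.card ι), (t - ((Fintype.equivFin ι).symm j).1) := by
    intro t
    rw [Equiv.prod_comp (Fintype.equivFin ι).symm (fun i : ι => t - (i.1 : ℂ)), Fintype.prod_sigma]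
    rw [finprod_eq_prod_of_mulSupport_subset (s := hfin.toFinset)]
    · rw [Finset.prod_apply, ← Finset.prod_coe_sort]
      refine Finset.prod_congr rfl fun u _ => ?_
      simp only [Finset.prod_const, Finset.card_univ, Fintype.card_fin]
      conv_lhs => rw [← Int.toNat_of_nonneg (hDnn u)]
      rw [zpow_natCast]
      rfl
    · intro u hu
      simp only [Finite.coe_toFinset, Function.mem_support]
      intro h0
      apply hu
      ext z
      simp [h0]
  refine ⟨Fintype.card ι, fun j => ((Fintype.equivFin ι).symm j).1, g, hg,
    fun t ht => hg0 ⟨t, ht⟩, fun j => ?_, ?_⟩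
  · refine D.supportWithinDomain ?_
    exact hfin.mem_toFinset.1 ((Fintype.equivFin ι).symm j).1.2
  · refine eqOn_closedBall_of_eventuallyEq_codiscreteWithin hR hf ?_ ?_
    · refine AnalyticOnNhd.mul ?_ hg
      intro x _
      fun_prop
    · refine hfg.trans (Filter.Eventually.of_forall fun t => ?_)
      simp only [Pi.smul_apply', smul_eq_mul]
      rw [hprod t]

/-- If `p / q` is bounded, where `p` and `q` are analytic on a closed disc then `q`
divides `p`. -/
theorem exists_analyticOnNhd_eq_mul_of_norm_le {p q : ℂ → ℂ} {R C : ℝ} (hR : 0 < R)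
    (hp : AnalyticOnNhd ℂ p (closedBall 0 R)) (hq : AnalyticOnNhd ℂ q (closedBall 0 R))
    (hC : ∀ t ∈ closedBall (0 : ℂ) R, ‖p t‖ ≤ C * ‖q t‖) :
    ∃ h : ℂ → ℂ, AnalyticOnNhd ℂ h (closedBall 0 R) ∧
      ∀ t ∈ closedBall (0 : ℂ) R, p t = h t * q t := by
  have hm : MeromorphicOn (p / q) (closedBall 0 R) := hp.meromorphicOn.div hq.meromorphicOn
  set h := toMeromorphicNFOn (p / q) (closedBall 0 R) with hh
  have hNF : MeromorphicNFOn h (closedBall 0 R) :=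
    meromorphicNFOn_toMeromorphicNFOn _ _
  have han : AnalyticOnNhd ℂ h (closedBall 0 R) := by
    intro x hx
    rw [← (hNF hx).meromorphicOrderAt_nonneg_iff_analyticAt, hh,
      meromorphicOrderAt_toMeromorphicNFOn hm hx]
    by_contra hneg
    have htend := tendsto_cobounded_of_meromorphicOrderAt_neg (not_le.1 hneg)
    rw [← tendsto_norm_atTop_iff_cobounded] at htend
    have h2 : ∃ᶠ y in nhdsWithin x {x}ᶜ, y ∈ closedBall (0 : ℂ) R :=
      accPt_iff_frequently_nhdsNE.1 (accPt_closedBall_complex hR hx)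
    obtain ⟨y, hy, hy'⟩ := (h2.and_eventually (htend.eventually_gt_atTop (max C 0))).exists
    have h3 := hC y hy
    have h4 : ‖(p / q) y‖ ≤ max C 0 := by
      rw [Pi.div_apply, norm_div]
      refine div_le_of_le_mul₀ (norm_nonneg _) (le_max_right _ _) (h3.trans ?_)
      gcongr
      exact le_max_left _ _
    linarith
  refine ⟨h, han, eqOn_closedBall_of_eventuallyEq_codiscreteWithin hR hp (han.mul hq) ?_⟩
  filter_upwards [toMeromorphicNFOn_eqOn_codiscrete hm, Filter.self_mem_codiscreteWithin _]
    with t h1 ht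
  rcases eq_or_ne (q t) 0 with h2 | h2
  · have h3 := hC t ht
    rw [h2, norm_zero, mul_zero] at h3
    simp [h2, norm_le_zero_iff.1 h3]
  · rw [hh, ← h1, Pi.div_apply, div_mul_cancel₀ _ h2]

/-- Power sums of the zeros of an analytic function as logarithmic residues. -/
theorem circleIntegral_pow_mul_logDeriv {f u : ℂ → ℂ} {r R : ℝ} (hr : 0 < r) (hrR : r < R) {n : ℕ}
    {τ : Fin n → ℂ} (hu : AnalyticOnNhd ℂ u (closedBall 0 R))
    (hu0 : ∀ t ∈ closedBall (0 : ℂ) R, u t ≠ 0) (hτ : ∀ i, τ i ∈ ball (0 : ℂ) r)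
    (hfu : ∀ t ∈ closedBall (0 : ℂ) R, f t = (∏ i, (t - τ i)) * u t) (k : ℕ) :
    (∮ s in C(0, r), s ^ k * logDeriv f s) = (2 * Real.pi * Complex.I) * ∑ i, τ i ^ k := by
  have hsub : closedBall (0 : ℂ) r ⊆ closedBall 0 R := closedBall_subset_closedBall hrR.le
  have hne : ∀ s ∈ sphere (0 : ℂ) r, ∀ i, s - τ i ≠ 0 := by
    intro s hs i h
    have h1 := hτ i
    rw [← sub_eq_zero.1 h] at h1
    simp only [mem_sphere, mem_ball] at hs h1
    linarith
  have hlog : ∀ s ∈ sphere (0 : ℂ) r,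
      s ^ k * logDeriv f s = (∑ i, (s - τ i)⁻¹ • s ^ k) + s ^ k * logDeriv u s := by
    intro s hs
    have hsR : s ∈ ball (0 : ℂ) R := by
      simp only [mem_sphere, mem_ball] at hs ⊢
      linarith
    have hev : f =ᶠ[nhds s] fun t => (∏ i, (t - τ i)) * u t := by
      filter_upwards [isOpen_ball.mem_nhds hsR] with t ht
      exact hfu t (ball_subset_closedBall ht)
    have h1 : logDeriv f s = logDeriv (fun t => (∏ i, (t - τ i)) * u t) s := by
      rw [logDeriv_apply, logDeriv_apply, hev.deriv_eq, hev.self_of_nhds]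
    have hus := hu s (ball_subset_closedBall hsR)
    rw [h1, logDeriv_mul s (Finset.prod_ne_zero_iff.2 fun i _ => hne s hs i)
      (hu0 s (ball_subset_closedBall hsR)) (by fun_prop) hus.differentiableAt,
      logDeriv_prod (fun i _ => hne s hs i) (fun i _ => by fun_prop), mul_add, Finset.mul_sum]
    congr 1
    refine Finset.sum_congr rfl fun i _ => ?_
    rw [logDeriv_apply]
    simp [mul_comm]
  have hcu : ContinuousOn (fun s => s ^ k * logDeriv u s) (closedBall 0 r) := by
    refine ContinuousOn.mul (by fun_prop) ?_
    refine ContinuousOn.div ?_ ?_ fun t ht => hu0 t (hsub ht)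
    · exact fun t ht => (hu.deriv t (hsub ht)).continuousAt.continuousWithinAt
    · exact fun t ht => (hu t (hsub ht)).continuousAt.continuousWithinAt
  have hdu : ∀ t ∈ ball (0 : ℂ) r, DifferentiableAt ℂ (fun s => s ^ k * logDeriv u s) t := by
    intro t ht
    have ht' := hsub (ball_subset_closedBall ht)
    refine DifferentiableAt.mul (by fun_prop) ?_
    exact (hu.deriv t ht').differentiableAt.div (hu t ht').differentiableAt (hu0 t ht')
  have hci : ∀ i ∈ (Finset.univ : Finset (Fin n)),
      CircleIntegrable (fun s => (s - τ i)⁻¹ • s ^ k) 0 r := by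
    intro i _
    refine ContinuousOn.circleIntegrable hr.le ?_
    refine ContinuousOn.smul (ContinuousOn.inv₀ (by fun_prop) fun s hs => hne s hs i) (by fun_prop)
  rw [circleIntegral.integral_congr hr.le hlog, circleIntegral.integral_add
      (CircleIntegrable.fun_sum _ hci)
      ((hcu.mono sphere_subset_closedBall).circleIntegrable hr.le),
    Complex.circleIntegral_eq_zero_of_differentiable_on_off_countable hr.le countable_empty hcu
      (fun t ht => hdu t ht.1), add_zero, circleIntegral.integral_fun_sum hci, Finset.mul_sum]
  refine Finset.sum_congr rfl fun i _ => ?_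
  rw [DifferentiableOn.circleIntegral_sub_inv_smul (by fun_prop) (hτ i), smul_eq_mul]

/-- Tube lemma along a compact set of complex parameters. -/
theorem exists_ball_forall_mem_of_isCompact {E : Type*} [NormedAddCommGroup E] {Ω : Set (E × ℂ)}
    (hΩ : IsOpen Ω) {K : Set ℂ} (hK : IsCompact K) {z₀ : E} (h : ∀ s ∈ K, (z₀, s) ∈ Ω) :
    ∃ ε > 0, ∀ z ∈ ball z₀ ε, ∀ s ∈ K, (z, s) ∈ Ω := by
  obtain ⟨V, T, hV, -, hzV, hKT, hVT⟩ := generalized_tube_lemma isCompact_singleton hK hΩ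
    (fun x hx => by
      obtain ⟨h1, h2⟩ := hx
      have := h x.2 h2
      rwa [← show x.1 = z₀ from h1] at this)
  obtain ⟨ε, hε, hεV⟩ := Metric.isOpen_iff.1 hV z₀ (hzV rfl)
  exact ⟨ε, hε, fun z hz s hs => hVT ⟨hεV hz, hKT hs⟩⟩

/-- Directional derivatives of a holomorphic function are holomorphic. -/
theorem differentiableOn_deriv_line {E : Type*} [NormedAddCommGroup E] [NormedSpace ℂ E]
    {f : E → ℂ} {U : Set E} (hU : IsOpen U) (hf : DifferentiableOn ℂ f U) (e : E) :
    DifferentiableOn ℂ (fun z => deriv (fun t : ℂ => f (z + t • e)) 0) U := by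
  intro z₀ hz₀
  refine DifferentiableAt.differentiableWithinAt ?_
  have hΩ : IsOpen {x : E × ℂ | x.1 + x.2 • e ∈ U} := hU.preimage (by fun_prop)
  obtain ⟨r, hr, hrU⟩ := Metric.nhds_basis_closedBall.mem_iff.1
    ((hΩ.preimage (f := fun t : ℂ => (z₀, t)) (by fun_prop)).mem_nhds
      (show (0 : ℂ) ∈ _ by simpa using hz₀))
  obtain ⟨ε, hε, hin⟩ := exists_ball_forall_mem_of_isCompact hΩ (isCompact_closedBall (0 : ℂ) r) hrU
  have hG : DifferentiableOn ℂ (fun x : E × ℂ => (x.2 ^ 2)⁻¹ * f (x.1 + x.2 • e))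
      {x : E × ℂ | x.1 + x.2 • e ∈ U ∧ x.2 ≠ 0} := by
    refine DifferentiableOn.mul (DifferentiableOn.inv (by fun_prop) ?_) ?_
    · exact fun x hx => pow_ne_zero _ hx.2
    · exact hf.comp (by fun_prop) fun x hx => hx.1
  have hint := differentiableOn_circleIntegral_param (V := ball z₀ ε)
    (hΩ.inter (isOpen_ne_fun continuous_snd continuous_const)) hG hr.le ?_
  · have h1 : DifferentiableOn ℂ (fun z => deriv (fun t : ℂ => f (z + t • e)) 0) (ball z₀ ε) := by
      refine (hint.const_smul (2 * Real.pi * Complex.I : ℂ)⁻¹).congr fun z hz => ?_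
      have h2 : DifferentiableOn ℂ (fun t : ℂ => f (z + t • e)) (closedBall 0 r) :=
        hf.comp (by fun_prop) fun t ht => hin z hz t ht
      have h3 := h2.deriv_eq_smul_circleIntegral hr
      simp only [sub_zero, one_div, smul_eq_mul] at h3
      rw [Pi.smul_apply, h3, smul_eq_mul, inv_mul_cancel_left₀ Complex.two_pi_I_ne_zero]
    exact h1.differentiableAt (ball_mem_nhds _ hε)
  · intro z hz s hs
    refine ⟨hin z hz s (by simp [hs]), fun h => ?_⟩
    rw [show s = 0 from h, norm_zero] at hs
    exact hr.ne hs

/-- If the power sums of finitely many functions are holomorphic, so are their elementary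
symmetric functions. -/
theorem differentiableOn_esymm_of_powerSum {E : Type*} [NormedAddCommGroup E] [NormedSpace ℂ E]
    {N : ℕ} {τ : E → Fin N → ℂ} {B : Set E}
    (h : ∀ k, DifferentiableOn ℂ (fun z => ∑ i, τ z i ^ k) B) (k : ℕ) :
    DifferentiableOn ℂ (fun z => MvPolynomial.aeval (τ z) (MvPolynomial.esymm (Fin N) ℂ k)) B := by
  induction k using Nat.strong_induction_on with
  | _ k ih =>
    rcases Nat.eq_zero_or_pos k with rfl | hk
    · simp
    · have key : ∀ z, MvPolynomial.aeval (τ z) (MvPolynomial.esymm (Fin N) ℂ k) =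
          (k : ℂ)⁻¹ * ((-1) ^ (k + 1) * ∑ a ∈ Finset.HasAntidiagonal.antidiagonal k with a.1 < k,
            (-1) ^ a.1 * MvPolynomial.aeval (τ z) (MvPolynomial.esymm (Fin N) ℂ a.1) *
              ∑ i, τ z i ^ a.2) := by
        intro z
        have h1 := congrArg (MvPolynomial.aeval (τ z)) (MvPolynomial.mul_esymm_eq_sum (Fin N) ℂ k)
        simp only [map_mul, map_sum, map_pow, map_neg, map_one, map_natCast, MvPolynomial.psum,
          MvPolynomial.aeval_X] at h1
        rw [← h1, inv_mul_cancel_left₀ (by exact_mod_cast hk.ne')]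
      refine DifferentiableOn.congr ?_ fun z _ => key z
      refine DifferentiableOn.const_mul (DifferentiableOn.const_mul
        (DifferentiableOn.fun_sum fun a ha => ?_) _) _
      exact ((ih a.1 (Finset.mem_filter.1 ha).2).const_mul _).mul (h a.2)

theorem differentiableOn_coeff_prod_X_sub_C {E : Type*} [NormedAddCommGroup E] [NormedSpace ℂ E]
    {N : ℕ} {τ : E → Fin N → ℂ} {B : Set E}
    (h : ∀ k, DifferentiableOn ℂ (fun z => ∑ i, τ z i ^ k) B) (k : ℕ) :
    DifferentiableOn ℂ
      (fun z => (∏ i, (Polynomial.X - Polynomial.C (τ z i))).coeff k) B := by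
  have hdeg : ∀ z, (∏ i, (Polynomial.X - Polynomial.C (τ z i))).natDegree = N := fun z => by
    simp
  rcases le_or_gt k N with hk | hk
  · refine ((differentiableOn_esymm_of_powerSum h (N - k)).const_mul ((-1) ^ (N - k))).congr
      fun z _ => ?_
    have h1 := Multiset.prod_X_sub_C_coeff (Finset.univ.val.map (τ z)) (k := k) (by simpa using hk)
    rw [Multiset.map_map] at h1
    rw [MvPolynomial.aeval_esymm_eq_multiset_esymm]
    simp only [Multiset.card_map, Finset.card_val, Finset.card_univ, Fintype.card_fin] at h1
    exact h1
  · refine (differentiableOn_const (0 : ℂ)).congr fun z _ => ?_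
    exact Polynomial.coeff_eq_zero_of_natDegree_lt ((hdeg z).trans_lt hk)

theorem differentiableOn_eval_of_coeff {E : Type*} [NormedAddCommGroup E] [NormedSpace ℂ E]
    {N : ℕ} {W : E → Polynomial ℂ} {B : Set E} (hN : ∀ z ∈ B, (W z).natDegree ≤ N)
    (hW : ∀ k, DifferentiableOn ℂ (fun z => (W z).coeff k) B) :
    DifferentiableOn ℂ (fun x : E × ℂ => (W x.1).eval x.2) {x | x.1 ∈ B} := by
  have h : DifferentiableOn ℂ (fun x : E × ℂ => ∑ k ∈ Finset.range (N + 1),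
      (W x.1).coeff k * x.2 ^ k) {x | x.1 ∈ B} := by
    refine DifferentiableOn.fun_sum fun k _ => DifferentiableOn.mul ?_ (by fun_prop)
    exact (hW k).comp (f := fun x : E × ℂ => x.1) (by fun_prop) fun x hx => hx
  refine h.congr fun x hx => ?_
  exact Polynomial.eval_eq_sum_range' (Nat.lt_succ_of_le (hN x.1 hx)) x.2

/-- A weak form of the Weierstrass preparation theorem in a direction `e` such that `f` does not
vanish on the line through `a` directed by `e`, except possibly at `a`. -/
theorem exists_weierstrass_polynomial {E : Type*} [NormedAddCommGroup E] [NormedSpace ℂ E]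
    {f : E → ℂ} {U : Set E} (hU : IsOpen U) (hf : DifferentiableOn ℂ f U) {a e : E} {R : ℝ}
    (hR : 0 < R) (hline : ∀ t ∈ closedBall (0 : ℂ) R, a + t • e ∈ U)
    (hne : ∀ t ∈ closedBall (0 : ℂ) R, t ≠ 0 → f (a + t • e) ≠ 0) :
    ∃ ε > 0, ∃ (N : ℕ) (W : E → Polynomial ℂ) (v : E → ℂ),
      (∀ z ∈ ball a ε, (W z).Monic) ∧ (∀ z ∈ ball a ε, (W z).natDegree = N) ∧
      (∀ k, DifferentiableOn ℂ (fun z => (W z).coeff k) (ball a ε)) ∧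
      W a = Polynomial.X ^ N ∧ DifferentiableOn ℂ v (ball a ε) ∧
      (∀ z ∈ ball a ε, f z = (W z).eval 0 * v z) ∧
      (∀ z ∈ ball a ε, ∀ t ∈ closedBall (0 : ℂ) R, z + t • e ∈ U) ∧
      ∀ z ∈ ball a ε, ∀ t ∈ closedBall (0 : ℂ) R, f (z + t • e) = 0 → (W z).eval t = 0 := by
  have hΩ : IsOpen {x : E × ℂ | x.1 + x.2 • e ∈ U} := hU.preimage (by fun_prop)
  have hfG : DifferentiableOn ℂ (fun x : E × ℂ => f (x.1 + x.2 • e))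
      {x : E × ℂ | x.1 + x.2 • e ∈ U} := hf.comp (by fun_prop) fun x hx => hx
  have hΩ' : IsOpen ({x : E × ℂ | x.1 + x.2 • e ∈ U} ∩
      (fun x : E × ℂ => f (x.1 + x.2 • e)) ⁻¹' {0}ᶜ) :=
    hfG.continuousOn.isOpen_inter_preimage hΩ isOpen_compl_singleton
  set Ω' := {x : E × ℂ | x.1 + x.2 • e ∈ U} ∩ (fun x : E × ℂ => f (x.1 + x.2 • e)) ⁻¹' {0}ᶜ
  have hr : 0 < R / 2 := by positivity
  have hrR : R / 2 < R := by linarith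
  obtain ⟨ε₁, hε₁, hin⟩ := exists_ball_forall_mem_of_isCompact hΩ
    (isCompact_closedBall (0 : ℂ) R) hline
  obtain ⟨ε₂, hε₂, hann⟩ := exists_ball_forall_mem_of_isCompact hΩ' (z₀ := a)
    ((isCompact_closedBall (0 : ℂ) R).diff isOpen_ball (s := closedBall 0 R) (t := ball 0 (R / 2)))
    (fun s hs => ⟨hline s hs.1, hne s hs.1 fun h => hs.2 (by simp [h, hr])⟩)
  have hε₀ : 0 < min ε₁ ε₂ := lt_min hε₁ hε₂
  set ε₀ := min ε₁ ε₂
  replace hin : ∀ z ∈ ball a ε₀, ∀ s ∈ closedBall (0 : ℂ) R, z + s • e ∈ U :=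
    fun z hz => hin z (ball_subset_ball (min_le_left _ _) hz)
  replace hann : ∀ z ∈ ball a ε₀, ∀ s ∈ closedBall (0 : ℂ) R, s ∉ ball (0 : ℂ) (R / 2) →
      f (z + s • e) ≠ 0 :=
    fun z hz s hs hs' => (hann z (ball_subset_ball (min_le_right _ _) hz) s ⟨hs, hs'⟩).2
  have hana : ∀ z ∈ ball a ε₀, AnalyticOnNhd ℂ (fun t : ℂ => f (z + t • e)) (closedBall 0 R) := by
    intro z hz
    have h1 : DifferentiableOn ℂ (fun t : ℂ => f (z + t • e)) ((fun t : ℂ => z + t • e) ⁻¹' U) :=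
      hf.comp (by fun_prop) fun x hx => hx
    exact (h1.analyticOnNhd (hU.preimage (by fun_prop))).mono fun t ht => hin z hz t ht
  have hfac : ∀ z ∈ ball a ε₀, ∃ n : ℕ, ∃ (τ : Fin n → ℂ) (u : ℂ → ℂ),
      AnalyticOnNhd ℂ u (closedBall 0 R) ∧
      (∀ t ∈ closedBall (0 : ℂ) R, u t ≠ 0) ∧ (∀ i, τ i ∈ ball (0 : ℂ) (R / 2)) ∧
      ∀ t ∈ closedBall (0 : ℂ) R, f (z + t • e) = (∏ i, (t - τ i)) * u t := by
    intro z hz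
    have hRmem : (R : ℂ) ∈ closedBall (0 : ℂ) R := by simp [abs_of_pos hR]
    have hRn : (R : ℂ) ∉ ball (0 : ℂ) (R / 2) := by simp [abs_of_pos hR, hR.le]
    obtain ⟨n, τ, u, h1, h2, h3, h4⟩ := exists_prod_sub_mul_of_analyticOnNhd_closedBall hR
      (hana z hz) hRmem (hann z hz _ hRmem hRn)
    refine ⟨n, τ, u, h1, h2, fun i => ?_, h4⟩
    by_contra hi
    refine hann z hz _ (h3 i) hi ?_
    rw [h4 _ (h3 i), Finset.prod_eq_zero (Finset.mem_univ i) (sub_self _), zero_mul]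
  choose! n hn using hfac
  -- the logarithmic residues are holomorphic
  set S : ℕ → E → ℂ := fun k z =>
    (2 * Real.pi * Complex.I)⁻¹ * ∮ s in C(0, R / 2), s ^ k * logDeriv (fun t : ℂ => f (z + t • e)) s
    with hS
  have hSdiff : ∀ k, DifferentiableOn ℂ (S k) (ball a ε₀) := by
    intro k
    refine DifferentiableOn.const_mul ?_ _
    have hG : DifferentiableOn ℂ (fun x : E × ℂ => x.2 ^ k *
        (deriv (fun t : ℂ => f (x.1 + x.2 • e + t • e)) 0 / f (x.1 + x.2 • e))) Ω' := by
      simp only [div_eq_mul_inv]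
      refine DifferentiableOn.mul (by fun_prop) (DifferentiableOn.mul ?_
        (DifferentiableOn.inv (hfG.mono inter_subset_left) fun x hx => hx.2))
      exact (differentiableOn_deriv_line hU hf e).comp (f := fun x : E × ℂ => x.1 + x.2 • e)
        (by fun_prop) fun x hx => hx.1
    refine (differentiableOn_circleIntegral_param hΩ' hG hr.le ?_).congr fun z hz => ?_
    · intro z hz s hs
      have hsR : s ∈ closedBall (0 : ℂ) R := by simp [hs, hrR.le]
      exact ⟨hin z hz s hsR, hann z hz s hsR (by simp [hs])⟩
    · refine circleIntegral.integral_congr hr.le fun s _ => ?_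
      simp only [logDeriv_apply]
      congr 2
      have h1 := deriv_comp_const_add (fun t : ℂ => f (z + t • e)) s 0
      rw [add_zero] at h1
      rw [← h1]
      simp only [add_smul, add_assoc]
  have hSeq : ∀ z ∈ ball a ε₀, ∀ {m : ℕ} (τ : Fin m → ℂ) (u : ℂ → ℂ),
      AnalyticOnNhd ℂ u (closedBall 0 R) →
      (∀ t ∈ closedBall (0 : ℂ) R, u t ≠ 0) → (∀ i, τ i ∈ ball (0 : ℂ) (R / 2)) →
      (∀ t ∈ closedBall (0 : ℂ) R, f (z + t • e) = (∏ i, (t - τ i)) * u t) →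
      ∀ k, S k z = ∑ i, τ i ^ k := by
    intro z hz m τ u h1 h2 h3 h4 k
    rw [hS]
    simp only
    rw [circleIntegral_pow_mul_logDeriv hr hrR h1 h2 h3 h4 k,
      inv_mul_cancel_left₀ Complex.two_pi_I_ne_zero]
  have hS0 : ∀ z ∈ ball a ε₀, S 0 z = n z := by
    intro z hz
    obtain ⟨τ, u, h1, h2, h3, h4⟩ := hn z hz
    rw [hSeq z hz τ u h1 h2 h3 h4]
    simp
  have ha₀ : a ∈ ball a ε₀ := mem_ball_self hε₀
  obtain ⟨ε, hε, hεn⟩ : ∃ ε > 0, ball a ε ⊆ ball a ε₀ ∩ {z | n z = n a} := by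
    have h1 : ContinuousAt (S 0) a := (hSdiff 0).continuousOn.continuousAt (isOpen_ball.mem_nhds ha₀)
    have h2 := (h1 (ball_mem_nhds _ one_pos))
    obtain ⟨ε, hε, h3⟩ := Metric.mem_nhds_iff.1 (Filter.inter_mem (isOpen_ball.mem_nhds ha₀) h2)
    refine ⟨ε, hε, fun z hz => ⟨(h3 hz).1, ?_⟩⟩
    have h4 : dist (S 0 z) (S 0 a) < 1 := (h3 hz).2
    rw [hS0 z (h3 hz).1, hS0 a ha₀, dist_eq_norm] at h4
    have h5 : ‖(((n z : ℤ) - (n a : ℤ) : ℤ) : ℂ)‖ < 1 := by push_cast; exact h4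
    rw [Complex.norm_intCast] at h5
    have h6 : |(n z : ℤ) - n a| < 1 := by exact_mod_cast h5
    have h7 := Int.abs_lt_one_iff.1 h6
    show n z = n a
    omega
  have hfac2 : ∀ z ∈ ball a ε, ∃ (τ : Fin (n a) → ℂ) (u : ℂ → ℂ),
      AnalyticOnNhd ℂ u (closedBall 0 R) ∧
      (∀ t ∈ closedBall (0 : ℂ) R, u t ≠ 0) ∧ (∀ i, τ i ∈ ball (0 : ℂ) (R / 2)) ∧
      ∀ t ∈ closedBall (0 : ℂ) R, f (z + t • e) = (∏ i, (t - τ i)) * u t := by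
    intro z hz
    have h1 := hn z (hεn hz).1
    rw [show n z = n a from (hεn hz).2] at h1
    exact h1
  choose! τ u hu hu0 hτ hτu using hfac2
  have hpow : ∀ k, DifferentiableOn ℂ (fun z => ∑ i, τ z i ^ k) (ball a ε) := fun k =>
    ((hSdiff k).mono fun z hz => (hεn hz).1).congr fun z hz =>
      (hSeq z (hεn hz).1 (τ z) (u z) (hu z hz) (hu0 z hz) (hτ z hz) (hτu z hz) k).symm
  have hcoeff := differentiableOn_coeff_prod_X_sub_C hpow
  have haε : a ∈ ball a ε := mem_ball_self hε
  set W : E → Polynomial ℂ := fun z => ∏ i, (Polynomial.X - Polynomial.C (τ z i)) with hW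
  have hWeval : ∀ z t, (W z).eval t = ∏ i, (t - τ z i) := fun z t => by
    simp [hW, Polynomial.eval_prod]
  have hWdeg : ∀ z, (W z).natDegree = n a := fun z => by simp [hW]
  have h0R : (0 : ℂ) ∈ closedBall (0 : ℂ) R := by simp [hR.le]
  have hv : DifferentiableOn ℂ (fun z => (2 * Real.pi * Complex.I)⁻¹ *
      ∮ s in C(0, R / 2), s⁻¹ * (f (z + s • e) / (W z).eval s)) (ball a ε) := by
    refine DifferentiableOn.const_mul ?_ _
    have hev := differentiableOn_eval_of_coeff (fun z _ => (hWdeg z).le) hcoeff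
    have hopen : IsOpen (({x : E × ℂ | x.1 ∈ ball a ε} ∩
        (fun x : E × ℂ => (W x.1).eval x.2) ⁻¹' {0}ᶜ) ∩ {x | x.1 + x.2 • e ∈ U} ∩ {x | x.2 ≠ 0}) := by
      refine IsOpen.inter (IsOpen.inter ?_ hΩ) (isOpen_ne_fun continuous_snd continuous_const)
      exact hev.continuousOn.isOpen_inter_preimage (isOpen_ball.preimage continuous_fst)
        isOpen_compl_singleton
    refine differentiableOn_circleIntegral_param (G := fun x : E × ℂ =>
      x.2⁻¹ * (f (x.1 + x.2 • e) / (W x.1).eval x.2)) hopen ?_ hr.le ?_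
    · simp only [div_eq_mul_inv]
      exact DifferentiableOn.mul (DifferentiableOn.inv (by fun_prop) fun x hx => hx.2)
        (DifferentiableOn.mul (hfG.mono fun x hx => hx.1.2)
          (DifferentiableOn.inv (hev.mono fun x hx => hx.1.1.1) fun x hx => hx.1.1.2))
    · intro z hz s hs
      have hsR : s ∈ closedBall (0 : ℂ) R := by simp [hs, hrR.le]
      have hs0 : s ≠ 0 := by
        rintro rfl
        rw [norm_zero] at hs
        exact hr.ne hs
      refine ⟨⟨⟨hz, ?_⟩, hin z (hεn hz).1 s hsR⟩, hs0⟩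
      intro h
      refine hann z (hεn hz).1 s hsR (by simp [hs]) ?_
      rw [hτu z hz s hsR, ← hWeval, show (W z).eval s = 0 from h, zero_mul]
  refine ⟨ε, hε, n a, W, _, fun z _ => Polynomial.monic_prod_of_monic _ _
    fun i _ => Polynomial.monic_X_sub_C _, fun z _ => hWdeg z, hcoeff, ?_, hv, ?_, ?_, ?_⟩
  · have h0 : ∀ i, τ a i = 0 := by
      intro i
      have hi : τ a i ∈ closedBall (0 : ℂ) R :=
        ball_subset_closedBall (ball_subset_ball hrR.le (hτ a haε i))
      by_contra h
      refine hne _ hi h ?_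
      rw [hτu a haε _ hi, Finset.prod_eq_zero (Finset.mem_univ i) (sub_self _), zero_mul]
    simp [hW, h0]
  · intro z hz
    have h1 : (∮ s in C(0, R / 2), s⁻¹ * (f (z + s • e) / (W z).eval s)) =
        ∮ s in C(0, R / 2), (s - 0)⁻¹ • u z s := by
      refine circleIntegral.integral_congr hr.le fun s hs => ?_
      have hs' : ‖s‖ = R / 2 := by simpa using hs
      have hsR : s ∈ closedBall (0 : ℂ) R := by simp [hs', hrR.le]
      have hne' := hann z (hεn hz).1 s hsR (by simp [hs'])
      rw [hτu z hz s hsR, ← hWeval] at hne' ⊢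
      simp only [sub_zero, smul_eq_mul]
      rw [mul_div_cancel_left₀ _ (left_ne_zero_of_mul hne')]
    have h2 : DifferentiableOn ℂ (u z) (closedBall 0 (R / 2)) := fun t ht =>
      (hu z hz t (closedBall_subset_closedBall hrR.le ht)).differentiableAt.differentiableWithinAt
    rw [h1, h2.circleIntegral_sub_inv_smul (mem_ball_self hr), smul_eq_mul,
      inv_mul_cancel_left₀ Complex.two_pi_I_ne_zero, hWeval, ← hτu z hz 0 h0R, zero_smul, add_zero]
  · exact fun z hz => hin z (hεn hz).1
  · intro z hz t ht h
    rw [hτu z hz t ht] at h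
    rw [hWeval]
    exact (mul_eq_zero.1 h).resolve_right (hu0 z hz t ht)

theorem convex_preimage_line {E : Type*} [NormedAddCommGroup E] [NormedSpace ℂ E] {B : Set E}
    (hB : Convex ℝ B) (a e : E) : Convex ℝ ((fun t : ℂ => a + t • e) ⁻¹' B) := by
  intro x hx y hy c d hc hd hcd
  have h := hB hx hy hc hd hcd
  have h1 : a + (c • x + d • y) • e = c • (a + x • e) + d • (a + y • e) := by
    rw [add_smul, smul_assoc, smul_assoc, smul_add, smul_add]
    nth_rewrite 1 [← one_smul ℝ a, ← hcd]
    rw [add_smul]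
    abel
  rw [mem_preimage, h1]
  exact h

theorem analyticOnNhd_comp_line {E : Type*} [NormedAddCommGroup E] [NormedSpace ℂ E]
    {f : E → ℂ} {B : Set E} (hBo : IsOpen B) (hf : DifferentiableOn ℂ f B) (a e : E) :
    AnalyticOnNhd ℂ (fun t : ℂ => f (a + t • e)) ((fun t : ℂ => a + t • e) ⁻¹' B) := by
  have h1 : DifferentiableOn ℂ (fun t : ℂ => f (a + t • e)) ((fun t : ℂ => a + t • e) ⁻¹' B) :=
    hf.comp (by fun_prop) fun x hx => hx
  exact h1.analyticOnNhd (hBo.preimage (by fun_prop))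

/-- A holomorphic function on a convex open set which is nonzero at some point `z` does not vanish
near `a` on the punctured line joining `a` to `z`. -/
theorem eventually_line_ne_zero {E : Type*} [NormedAddCommGroup E] [NormedSpace ℂ E]
    {f : E → ℂ} {B : Set E} (hBo : IsOpen B) (hB : Convex ℝ B) (hf : DifferentiableOn ℂ f B)
    {a z : E} (ha : a ∈ B) (hz : z ∈ B) (hfz : f z ≠ 0) :
    ∀ᶠ t in nhdsWithin (0 : ℂ) {0}ᶜ, f (a + t • (z - a)) ≠ 0 := by
  have han := analyticOnNhd_comp_line hBo hf a (z - a)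
  have h0 : (0 : ℂ) ∈ (fun t : ℂ => a + t • (z - a)) ⁻¹' B := by simpa using ha
  have h1 : (1 : ℂ) ∈ (fun t : ℂ => a + t • (z - a)) ⁻¹' B := by simpa using hz
  refine (han 0 h0).eventually_eq_zero_or_eventually_ne_zero.resolve_left fun h => ?_
  have h2 := han.eqOn_zero_of_preconnected_of_eventuallyEq_zero
    (convex_preimage_line hB a (z - a)).isPreconnected h0 h h1
  simp only [one_smul, add_sub_cancel, Pi.zero_apply] at h2
  exact hfz h2

/-- Identity theorem for holomorphic functions on convex open sets. -/
theorem frequently_ne_zero_of_differentiableOn {E : Type*} [NormedAddCommGroup E]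
    [NormedSpace ℂ E] {f : E → ℂ} {B : Set E} (hBo : IsOpen B) (hB : Convex ℝ B)
    (hf : DifferentiableOn ℂ f B) {a z : E} (ha : a ∈ B) (hz : z ∈ B) (hfz : f z ≠ 0) :
    ∃ᶠ w in nhds a, f w ≠ 0 := by
  have h1 := (eventually_line_ne_zero hBo hB hf ha hz hfz).frequently
  have h2 : Filter.Tendsto (fun t : ℂ => a + t • (z - a)) (nhdsWithin 0 {0}ᶜ) (nhds a) := by
    have h3 : Continuous fun t : ℂ => a + t • (z - a) := by fun_prop
    have h4 := h3.tendsto 0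
    simp only [zero_smul, add_zero] at h4
    exact h4.mono_left nhdsWithin_le_nhds
  exact h2.frequently h1

/-- The circle integral formula gives a holomorphic quotient near a point, if the quotient is
bounded. -/
theorem exists_ball_eq_mul_of_norm_le {E : Type*} [NormedAddCommGroup E] [NormedSpace ℂ E]
    {p q : E → ℂ} {a : E} {δ C : ℝ} (hp : DifferentiableOn ℂ p (ball a δ))
    (hq : DifferentiableOn ℂ q (ball a δ)) {z : E} (hz : z ∈ ball a δ) (hqz : q z ≠ 0)
    (hC : ∀ w ∈ ball a δ, ‖p w‖ ≤ C * ‖q w‖) :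
    ∃ ε > 0, ∃ φ : E → ℂ, DifferentiableOn ℂ φ (ball a ε) ∧ ball a ε ⊆ ball a δ ∧
      ∀ w ∈ ball a ε, p w = φ w * q w := by
  have hδ : 0 < δ := pos_of_mem_ball hz
  have haδ : a ∈ ball a δ := mem_ball_self hδ
  set e := z - a with he
  have h1 := eventually_line_ne_zero isOpen_ball (convex_ball a δ) hq haδ hz hqz
  rw [eventually_nhdsWithin_iff] at h1
  have hΩ : IsOpen {x : E × ℂ | x.1 + x.2 • e ∈ ball a δ} := isOpen_ball.preimage (by fun_prop)
  have h2 : ∀ᶠ t : ℂ in nhds 0, a + t • e ∈ ball a δ :=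
    (isOpen_ball.preimage (f := fun t : ℂ => a + t • e) (by fun_prop)).mem_nhds
      (by simpa using hδ)
  obtain ⟨r, hr, hr'⟩ := Metric.nhds_basis_closedBall.mem_iff.1 (Filter.inter_mem h1 h2)
  obtain ⟨ε₁, hε₁, hin⟩ := exists_ball_forall_mem_of_isCompact hΩ (isCompact_closedBall (0 : ℂ) r)
    fun s hs => (hr' hs).2
  have hqG : DifferentiableOn ℂ (fun x : E × ℂ => q (x.1 + x.2 • e))
      {x : E × ℂ | x.1 + x.2 • e ∈ ball a δ} := hq.comp (by fun_prop) fun x hx => hx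
  have hpG : DifferentiableOn ℂ (fun x : E × ℂ => p (x.1 + x.2 • e))
      {x : E × ℂ | x.1 + x.2 • e ∈ ball a δ} := hp.comp (by fun_prop) fun x hx => hx
  have hΩ' : IsOpen (({x : E × ℂ | x.1 + x.2 • e ∈ ball a δ} ∩
      (fun x : E × ℂ => q (x.1 + x.2 • e)) ⁻¹' {0}ᶜ) ∩ {x | x.2 ≠ 0}) :=
    (hqG.continuousOn.isOpen_inter_preimage hΩ isOpen_compl_singleton).inter
      (isOpen_ne_fun continuous_snd continuous_const)
  obtain ⟨ε₂, hε₂, hin₂⟩ := exists_ball_forall_mem_of_isCompact hΩ' (isCompact_sphere (0 : ℂ) r)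
    (z₀ := a) (fun s hs => by
      have hs0 : s ≠ 0 := by
        rintro rfl
        simp only [mem_sphere, dist_self] at hs
        exact hr.ne hs
      have hs' := hr' (sphere_subset_closedBall hs)
      exact ⟨⟨hs'.2, hs'.1 hs0⟩, hs0⟩)
  refine ⟨min ε₁ ε₂, lt_min hε₁ hε₂, fun w => (2 * Real.pi * Complex.I)⁻¹ *
      ∮ s in C(0, r), s⁻¹ * (p (w + s • e) / q (w + s • e)), ?_, ?_, ?_⟩
  · refine DifferentiableOn.const_mul ?_ _
    refine differentiableOn_circleIntegral_param (G := fun x : E × ℂ =>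
      x.2⁻¹ * (p (x.1 + x.2 • e) / q (x.1 + x.2 • e))) hΩ' ?_ hr.le ?_
    · simp only [div_eq_mul_inv]
      exact DifferentiableOn.mul (DifferentiableOn.inv (by fun_prop) fun x hx => hx.2)
        (DifferentiableOn.mul (hpG.mono fun x hx => hx.1.1)
          (DifferentiableOn.inv (hqG.mono fun x hx => hx.1.1) fun x hx => hx.1.2))
    · exact fun w hw s hs => hin₂ w (ball_subset_ball (min_le_right _ _) hw) s (by simpa using hs)
  · intro w hw
    have := hin w (ball_subset_ball (min_le_left _ _) hw) 0 (mem_closedBall_self hr.le)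
    simpa using this
  · intro w hw
    have hw1 := hin w (ball_subset_ball (min_le_left _ _) hw)
    have hw2 := hin₂ w (ball_subset_ball (min_le_right _ _) hw)
    obtain ⟨h, hh, hph⟩ := exists_analyticOnNhd_eq_mul_of_norm_le hr
      ((analyticOnNhd_comp_line isOpen_ball hp w e).mono fun t ht => hw1 t ht)
      ((analyticOnNhd_comp_line isOpen_ball hq w e).mono fun t ht => hw1 t ht)
      fun t ht => hC _ (hw1 t ht)
    have h3 : (∮ s in C(0, r), s⁻¹ * (p (w + s • e) / q (w + s • e))) =
        ∮ s in C(0, r), (s - 0)⁻¹ • h s := by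
      refine circleIntegral.integral_congr hr.le fun s hs => ?_
      have h4 : q (w + s • e) ≠ 0 := (hw2 s hs).1.2
      simp only [sub_zero, smul_eq_mul]
      rw [hph s (sphere_subset_closedBall hs), mul_div_cancel_right₀ _ h4]
    have h5 : DifferentiableOn ℂ h (closedBall 0 r) := fun t ht =>
      (hh t ht).differentiableAt.differentiableWithinAt
    have h6 := hph 0 (mem_closedBall_self hr.le)
    rw [zero_smul, add_zero] at h6
    beta_reduce
    rw [h3, h5.circleIntegral_sub_inv_smul (mem_ball_self hr), smul_eq_mul,
      inv_mul_cancel_left₀ Complex.two_pi_I_ne_zero, h6]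

/-- A quotient of holomorphic functions which is locally bounded is holomorphic. -/
theorem exists_eq_mul_of_locally_norm_le {E : Type*} [NormedAddCommGroup E] [NormedSpace ℂ E]
    {p q : E → ℂ} {B : Set E} (hBo : IsOpen B) (hB : Convex ℝ B) (hp : DifferentiableOn ℂ p B)
    (hq : DifferentiableOn ℂ q B) {z₁ : E} (hz₁ : z₁ ∈ B) (hqz₁ : q z₁ ≠ 0)
    (hC : ∀ a ∈ B, ∃ C : ℝ, ∀ᶠ w in nhds a, ‖p w‖ ≤ C * ‖q w‖) :
    ∃ φ : E → ℂ, DifferentiableOn ℂ φ B ∧ ∀ w ∈ B, p w = φ w * q w := by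
  have hloc : ∀ a ∈ B, ∃ ε > 0, ∃ φ : E → ℂ, DifferentiableOn ℂ φ (ball a ε) ∧ ball a ε ⊆ B ∧
      ∀ w ∈ ball a ε, p w = φ w * q w := by
    intro a ha
    obtain ⟨C, hCa⟩ := hC a ha
    obtain ⟨δ, hδ, h1⟩ := Metric.mem_nhds_iff.1 (Filter.inter_mem hCa (hBo.mem_nhds ha))
    obtain ⟨z, hz, hz'⟩ := ((frequently_ne_zero_of_differentiableOn hBo hB hq ha hz₁
      hqz₁).and_eventually (ball_mem_nhds a hδ)).exists
    have h2 : ball a δ ⊆ B := fun w hw => (h1 hw).2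
    obtain ⟨ε, hε, φ, h3, h4, h5⟩ := exists_ball_eq_mul_of_norm_le (hp.mono h2) (hq.mono h2) hz' hz
      fun w hw => (h1 hw).1
    exact ⟨ε, hε, φ, h3, h4.trans h2, h5⟩
  choose! ε hε φ hφ hεB hpφ using hloc
  refine ⟨fun z => φ z z, fun a ha => ?_, fun w hw => hpφ w hw w (mem_ball_self (hε w hw))⟩
  have hab := ball_mem_nhds a (hε a ha)
  refine (((hφ a ha).differentiableAt hab).congr_of_eventuallyEq ?_).differentiableWithinAt
  filter_upwards [hab] with w hw
  have hwB := hεB a ha hw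
  have hwb : ball w (ε w) ∈ nhds w := ball_mem_nhds w (hε w hwB)
  have hwa : ball a (ε a) ∈ nhds w := isOpen_ball.mem_nhds hw
  by_contra hne
  have hcont : ContinuousAt (fun y => φ w y - φ a y) w :=
    ((hφ w hwB).continuousOn.continuousAt hwb).sub ((hφ a ha).continuousOn.continuousAt hwa)
  have h1 := hcont.eventually_ne (sub_ne_zero.2 hne)
  have h0 : ∀ᶠ y in nhds w, y ∈ ball w (ε w) ∩ ball a (ε a) := Filter.inter_mem hwb hwa
  obtain ⟨y, hy, ⟨hy1, hy2⟩, hy3⟩ := ((frequently_ne_zero_of_differentiableOn hBo hB hq hwB hz₁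
    hqz₁).and_eventually (h0.and h1)).exists
  have h2 : (φ w y - φ a y) * q y = 0 := by
    rw [sub_mul, ← hpφ w hwB y hy1, ← hpφ a ha y hy2, sub_self]
  exact (mul_ne_zero hy3 hy) h2

/-- A bound for the roots of a monic polynomial. -/
theorem norm_le_of_scaleRoots_eval_eq_zero {Q : Polynomial ℂ} (hQ : Q.Monic) {p q : ℂ}
    (h : (Q.scaleRoots q).eval p = 0) :
    ‖p‖ ≤ (1 + ∑ i ∈ Finset.range Q.natDegree, ‖Q.coeff i‖) * ‖q‖ := by
  have hp : p ^ Q.natDegree = -∑ i ∈ Finset.range Q.natDegree,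
      Q.coeff i * q ^ (Q.natDegree - i) * p ^ i := by
    rw [Polynomial.eval_eq_sum_range, Polynomial.natDegree_scaleRoots, Finset.sum_range_succ] at h
    simp only [Polynomial.coeff_scaleRoots, hQ.coeff_natDegree, tsub_self, pow_zero, mul_one,
      one_mul] at h
    linear_combination h
  set n := Q.natDegree
  set S := ∑ i ∈ Finset.range n, ‖Q.coeff i‖
  have hS : 0 ≤ S := Finset.sum_nonneg fun i _ => norm_nonneg _
  by_contra! hlt
  have hqp : ‖q‖ ≤ ‖p‖ := by nlinarith [norm_nonneg q]
  have hp0 : 0 < ‖p‖ := lt_of_le_of_lt (by positivity) hlt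
  have h1 : ‖p‖ ^ n ≤ S * ‖q‖ * ‖p‖ ^ (n - 1) := by
    rw [← norm_pow, hp, norm_neg, Finset.sum_mul, Finset.sum_mul]
    refine (norm_sum_le _ _).trans (Finset.sum_le_sum fun i hi => ?_)
    have hi' := Finset.mem_range.1 hi
    rw [norm_mul, norm_mul, norm_pow, norm_pow, mul_assoc, mul_assoc]
    refine mul_le_mul_of_nonneg_left ?_ (norm_nonneg _)
    calc ‖q‖ ^ (n - i) * ‖p‖ ^ i = ‖q‖ * (‖q‖ ^ (n - 1 - i) * ‖p‖ ^ i) := by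
          rw [← mul_assoc, ← pow_succ']
          congr 2
          omega
      _ ≤ ‖q‖ * (‖p‖ ^ (n - 1 - i) * ‖p‖ ^ i) := by gcongr
      _ = ‖q‖ * ‖p‖ ^ (n - 1) := by
          rw [← pow_add]
          congr 2
          omega
  rcases Nat.eq_zero_or_pos n with hn | hn
  · have hS0 : S = 0 := by simp [S, hn]
    rw [hn, hS0] at h1
    simp at h1
    linarith
  · have h2 : ‖p‖ ^ n = ‖p‖ * ‖p‖ ^ (n - 1) := by
      rw [← pow_succ']
      congr 1
      omega
    rw [h2] at h1
    have h3 := le_of_mul_le_mul_right h1 (by positivity)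
    nlinarith [norm_nonneg q]

/-- The ring of holomorphic functions on a set. -/
def holoRing {E : Type*} [NormedAddCommGroup E] [NormedSpace ℂ E] (B : Set E) :
    Subring (B → ℂ) where
  carrier := {φ | ∃ F : E → ℂ, DifferentiableOn ℂ F B ∧ ∀ x : B, φ x = F x}
  mul_mem' := by
    rintro φ ψ ⟨F, hF, hφ⟩ ⟨G, hG, hψ⟩
    exact ⟨fun x => F x * G x, hF.mul hG, fun x => by simp [hφ, hψ]⟩
  one_mem' := ⟨fun _ => 1, differentiableOn_const 1, fun _ => rfl⟩
  add_mem' := by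
    rintro φ ψ ⟨F, hF, hφ⟩ ⟨G, hG, hψ⟩
    exact ⟨fun x => F x + G x, hF.add hG, fun x => by simp [hφ, hψ]⟩
  zero_mem' := ⟨fun _ => 0, differentiableOn_const 0, fun _ => rfl⟩
  neg_mem' := by
    rintro φ ⟨F, hF, hφ⟩
    exact ⟨fun x => -F x, hF.neg, fun x => by simp [hφ]⟩

namespace holoRing

variable {E : Type*} [NormedAddCommGroup E] [NormedSpace ℂ E] {B : Set E}

/-- The element of `holoRing B` given by a holomorphic function. -/
def mk (F : E → ℂ) (hF : DifferentiableOn ℂ F B) : holoRing B :=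
  ⟨fun x => F x, F, hF, fun _ => rfl⟩

/-- A function on the whole space which represents an element of `holoRing B`. -/
def ext (φ : holoRing B) : E → ℂ := φ.2.choose

theorem differentiableOn_ext (φ : holoRing B) : DifferentiableOn ℂ (ext φ) B := φ.2.choose_spec.1

/-- Evaluation at a point. -/
def evalAt (z : B) : holoRing B →+* ℂ := (Pi.evalRingHom (fun _ : B => ℂ) z).comp (holoRing B).subtype

theorem evalAt_eq_ext (φ : holoRing B) (z : B) : evalAt z φ = ext φ z := φ.2.choose_spec.2 z

@[simp]
theorem evalAt_mk (F : E → ℂ) (hF : DifferentiableOn ℂ F B) (z : B) : evalAt z (mk F hF) = F z :=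
  rfl

theorem ext_of_evalAt {φ ψ : holoRing B} (h : ∀ z, evalAt z φ = evalAt z ψ) : φ = ψ :=
  Subtype.ext (funext h)

theorem exists_ext_ne_zero {φ : holoRing B} (h : φ ≠ 0) : ∃ z ∈ B, ext φ z ≠ 0 := by
  by_contra! h0
  exact h (ext_of_evalAt fun z => by rw [evalAt_eq_ext, h0 z z.2, map_zero])

theorem isDomain (hBo : IsOpen B) (hB : Convex ℝ B) (hne : B.Nonempty) : IsDomain (holoRing B) := by
  have : Nontrivial (holoRing B) := by
    obtain ⟨z, hz⟩ := hne
    exact ⟨0, 1, fun h => zero_ne_one (α := ℂ) (by simpa using congrArg (evalAt ⟨z, hz⟩) h)⟩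
  have : NoZeroDivisors (holoRing B) := by
    refine ⟨fun {φ ψ} h => ?_⟩
    by_contra! h0
    obtain ⟨z, hz, hφz⟩ := exists_ext_ne_zero h0.1
    obtain ⟨w, hw, hψw⟩ := exists_ext_ne_zero h0.2
    have h1 := ((differentiableOn_ext φ).continuousOn.continuousAt
      (hBo.mem_nhds hz)).eventually_ne hφz
    obtain ⟨y, hy, hy', hyB⟩ := ((frequently_ne_zero_of_differentiableOn hBo hB
      (differentiableOn_ext ψ) hz hw hψw).and_eventually (h1.and (hBo.mem_nhds hz))).exists
    have h2 := congrArg (evalAt ⟨y, hyB⟩) h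
    rw [map_mul, map_zero, evalAt_eq_ext, evalAt_eq_ext] at h2
    exact mul_ne_zero hy' hy h2
  exact NoZeroDivisors.to_isDomain _

/-- A holomorphic function `p` such that `p / q` satisfies an integral equation is divisible
by `q`. -/
theorem dvd_of_scaleRoots (hBo : IsOpen B) (hB : Convex ℝ B) {p q : holoRing B} (hq : q ≠ 0)
    {P : Polynomial (holoRing B)} (hP : P.Monic) (h : (P.scaleRoots q).eval p = 0) : q ∣ p := by
  obtain ⟨z₁, hz₁, hqz₁⟩ := exists_ext_ne_zero hq
  have key : ∀ z : B, ‖ext p z‖ ≤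
      (1 + ∑ i ∈ Finset.range P.natDegree, ‖ext (P.coeff i) z‖) * ‖ext q z‖ := by
    intro z
    set Q := P.map (evalAt z) with hQ
    have hQm : Q.Monic := hP.map _
    have hQdeg : Q.natDegree = P.natDegree := hP.natDegree_map _
    have hb : (Q.scaleRoots (ext q z)).eval (ext p z) = 0 := by
      have h1 := congrArg (evalAt z) h
      rw [map_zero, ← Polynomial.eval_map_apply, Polynomial.map_scaleRoots _ _ _
        (by simp [hP.leadingCoeff]), evalAt_eq_ext, evalAt_eq_ext] at h1
      exact h1
    have h2 := norm_le_of_scaleRoots_eval_eq_zero hQm hb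
    rw [hQdeg] at h2
    simpa [hQ, Polynomial.coeff_map, evalAt_eq_ext] using h2
  have hC : ∀ a ∈ B, ∃ C : ℝ, ∀ᶠ w in nhds a, ‖ext p w‖ ≤ C * ‖ext q w‖ := by
    intro a ha
    have h1 : ContinuousAt (fun w => 1 + ∑ i ∈ Finset.range P.natDegree, ‖ext (P.coeff i) w‖) a := by
      refine continuousAt_const.add (tendsto_finsetSum _ fun i _ => ?_)
      exact ((differentiableOn_ext (P.coeff i)).continuousOn.continuousAt (hBo.mem_nhds ha)).norm
    refine ⟨1 + ∑ i ∈ Finset.range P.natDegree, ‖ext (P.coeff i) a‖ + 1, ?_⟩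
    filter_upwards [h1.eventually_le_const (lt_add_one _), hBo.mem_nhds ha] with w hw hwB
    refine (key ⟨w, hwB⟩).trans ?_
    gcongr
  obtain ⟨φ, hφ, hpφ⟩ := exists_eq_mul_of_locally_norm_le hBo hB (differentiableOn_ext p)
    (differentiableOn_ext q) hz₁ hqz₁ hC
  refine ⟨mk φ hφ, ext_of_evalAt fun z => ?_⟩
  rw [map_mul, evalAt_eq_ext, evalAt_eq_ext, evalAt_mk, hpφ z z.2, mul_comm]

theorem isIntegrallyClosed (hBo : IsOpen B) (hB : Convex ℝ B) (hne : B.Nonempty) :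
    IsIntegrallyClosed (holoRing B) := by
  have := isDomain hBo hB hne
  rw [isIntegrallyClosed_iff (FractionRing (holoRing B))]
  rintro x ⟨P, hP, hx⟩
  obtain ⟨p, q, hq, rfl⟩ := IsFractionRing.div_surjective (A := holoRing B) x
  have hq0 := nonZeroDivisors.ne_zero hq
  have h1 : (P.scaleRoots q).eval p = 0 := by
    apply IsFractionRing.injective (holoRing B) (FractionRing (holoRing B))
    rw [map_zero, ← Polynomial.aeval_algebraMap_apply_eq_algebraMap_eval]
    exact Polynomial.scaleRoots_aeval_eq_zero_of_aeval_div_eq_zero (IsFractionRing.injective _ _) hx hq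
  obtain ⟨c, rfl⟩ := dvd_of_scaleRoots hBo hB hq0 hP h1
  refine ⟨c, ?_⟩
  rw [map_mul, mul_div_cancel_left₀]
  exact fun h => hq0 (IsFractionRing.injective _ _ (h.trans (map_zero _).symm))

end holoRing

/-- A monic polynomial and another one over an integrally closed domain either have a nonzero constant in the
ideal which they generate or have a common monic factor of positive degree. -/
theorem exists_bezout_or_common_factor {A : Type*} [CommRing A] [IsDomain A]
    [IsIntegrallyClosed A] {F G : Polynomial A} (hF : F.Monic) :
    (∃ (α β : Polynomial A) (c : A), c ≠ 0 ∧ α * F + β * G = Polynomial.C c) ∨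
      ∃ h : Polynomial A, h.Monic ∧ h.natDegree ≠ 0 ∧ h ∣ F ∧ h ∣ G := by
  classical
  set K := FractionRing A
  have hinj : Function.Injective (algebraMap A K) := IsFractionRing.injective A K
  by_cases hcop : IsCoprime (F.map (algebraMap A K)) (G.map (algebraMap A K))
  · left
    obtain ⟨u, v, huv⟩ := hcop
    obtain ⟨b, hbm, hb⟩ := IsLocalization.integerNormalization_spec (nonZeroDivisors A) u
    obtain ⟨c, hcm, hc⟩ := IsLocalization.integerNormalization_spec (nonZeroDivisors A) v
    refine ⟨Polynomial.C c * IsLocalization.integerNormalization (nonZeroDivisors A) u,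
      Polynomial.C b * IsLocalization.integerNormalization (nonZeroDivisors A) v,
      b * c, mul_ne_zero (nonZeroDivisors.ne_zero hbm) (nonZeroDivisors.ne_zero hcm), ?_⟩
    apply Polynomial.map_injective _ hinj
    simp only [Polynomial.map_add, Polynomial.map_mul, Polynomial.map_C, hb, hc, map_mul,
      Algebra.smul_def, Polynomial.algebraMap_apply]
    linear_combination Polynomial.C (algebraMap A K b) * Polynomial.C (algebraMap A K c) * huv
  · right
    set F' := F.map (algebraMap A K)
    set G' := G.map (algebraMap A K)
    have hF'0 : F' ≠ 0 := (hF.map _).ne_zero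
    have hg0 : gcd F' G' ≠ 0 := fun h => hF'0 ((gcd_eq_zero_iff _ _).1 h).1
    set g := normalize (gcd F' G') with hg
    have hgm : g.Monic := Polynomial.monic_normalize hg0
    have hgF : g ∣ F' := normalize_dvd_iff.2 (gcd_dvd_left _ _)
    have hgG : g ∣ G' := normalize_dvd_iff.2 (gcd_dvd_right _ _)
    have hgu : ¬ IsUnit g := fun hu => hcop (by
      rw [← gcd_isUnit_iff]
      exact (normalize_associated _).isUnit hu)
    obtain ⟨h, hh⟩ := IsIntegrallyClosed.eq_map_mul_C_of_dvd K hF hgF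
    rw [hgm.leadingCoeff, map_one, mul_one] at hh
    have hhm : h.Monic := Polynomial.monic_of_injective hinj (hh ▸ hgm)
    refine ⟨h, hhm, fun h0 => hgu ?_, ?_, ?_⟩
    · rw [← hh, Polynomial.eq_one_of_monic_natDegree_zero hhm h0]
      simp
    · exact (Polynomial.map_dvd_map _ hinj hhm).1 (hh ▸ hgF)
    · exact (Polynomial.map_dvd_map _ hinj hhm).1 (hh ▸ hgG)

theorem exists_monic_holoRing_map_evalAt {E : Type*} [NormedAddCommGroup E] [NormedSpace ℂ E]
    {B : Set E} {N : ℕ} {W : E → Polynomial ℂ} (hm : ∀ z ∈ B, (W z).Monic)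
    (hN : ∀ z ∈ B, (W z).natDegree = N)
    (hW : ∀ k, DifferentiableOn ℂ (fun z => (W z).coeff k) B) :
    ∃ F : Polynomial (holoRing B), F.Monic ∧ ∀ z : B, F.map (holoRing.evalAt z) = W z := by
  set F : Polynomial (holoRing B) :=
    ∑ k ∈ Finset.range (N + 1), Polynomial.monomial k (holoRing.mk _ (hW k)) with hF
  have hco : ∀ k, F.coeff k = if k < N + 1 then holoRing.mk _ (hW k) else 0 := fun k => by
    simp [hF, Polynomial.coeff_monomial]
  refine ⟨F, Polynomial.monic_of_natDegree_le_of_coeff_eq_one N ?_ ?_, fun z => ?_⟩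
  · rw [Polynomial.natDegree_le_iff_coeff_eq_zero]
    intro k hk
    rw [hco, if_neg (by omega)]
  · rw [hco, if_pos (by omega)]
    refine holoRing.ext_of_evalAt fun z => ?_
    rw [holoRing.evalAt_mk, map_one, ← hN z z.2]
    exact hm z z.2
  · ext k
    rw [Polynomial.coeff_map, hco]
    split_ifs with h
    · rfl
    · rw [map_zero, Polynomial.coeff_eq_zero_of_natDegree_lt]
      rw [hN z z.2]
      omega

/-- Zeros of a holomorphic function on a line persist on nearby parallel lines. -/
theorem eventually_exists_zero_on_line {E : Type*} [NormedAddCommGroup E] [NormedSpace ℂ E]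
    {d : E → ℂ} {V : Set E} (hV : IsOpen V) (hd : DifferentiableOn ℂ d V) {y e : E} {r : ℝ}
    (hr : 0 < r) (hline : ∀ t ∈ closedBall (0 : ℂ) r, y + t • e ∈ V)
    (hne : ∀ t ∈ sphere (0 : ℂ) r, d (y + t • e) ≠ 0) (hdy : d y = 0) :
    ∀ᶠ z in nhds y, ∃ t ∈ closedBall (0 : ℂ) r, z + t • e ∈ V ∧ d (z + t • e) = 0 := by
  have hΩ : IsOpen {x : E × ℂ | x.1 + x.2 • e ∈ V} := hV.preimage (by fun_prop)
  have hdG : ContinuousOn (fun x : E × ℂ => d (x.1 + x.2 • e))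
      {x : E × ℂ | x.1 + x.2 • e ∈ V} := hd.continuousOn.comp (by fun_prop) fun x hx => hx
  obtain ⟨ε₁, hε₁, hin⟩ := exists_ball_forall_mem_of_isCompact hΩ
    (isCompact_closedBall (0 : ℂ) r) hline
  have hcs : ContinuousOn (fun t : ℂ => ‖d (y + t • e)‖) (sphere 0 r) :=
    (hd.continuousOn.comp (f := fun t : ℂ => y + t • e) (by fun_prop)
      fun t ht => hline t (sphere_subset_closedBall ht)).norm
  obtain ⟨t₀, ht₀, hmin⟩ := (isCompact_sphere (0 : ℂ) r).exists_isMinOn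
    (NormedSpace.sphere_nonempty.2 hr.le) hcs
  set m := ‖d (y + t₀ • e)‖ with hm
  have hm0 : 0 < m := norm_pos_iff.2 (hne t₀ ht₀)
  have hΩ' : IsOpen ({x : E × ℂ | x.1 + x.2 • e ∈ V} ∩
      (fun x : E × ℂ => ‖d (x.1 + x.2 • e)‖) ⁻¹' Ioi (m / 2)) :=
    hdG.norm.isOpen_inter_preimage hΩ isOpen_Ioi
  obtain ⟨ε₂, hε₂, hin₂⟩ := exists_ball_forall_mem_of_isCompact hΩ' (isCompact_sphere (0 : ℂ) r)
    (z₀ := y) (fun s hs => ⟨hline s (sphere_subset_closedBall hs),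
      lt_of_lt_of_le (by linarith) (isMinOn_iff.1 hmin s hs)⟩)
  have hy : y ∈ V := by simpa using hline 0 (mem_closedBall_self hr.le)
  have hdc : ∀ᶠ z in nhds y, ‖d z‖ < m / 2 := by
    have h1 : ContinuousAt (fun z => ‖d z‖) y :=
      (hd.continuousOn.continuousAt (hV.mem_nhds hy)).norm
    exact h1.eventually_lt_const (by simpa [hdy] using hm0)
  filter_upwards [ball_mem_nhds y hε₁, ball_mem_nhds y hε₂, hdc] with z hz1 hz2 hz3
  by_contra! hno
  have hno' : ∀ t ∈ closedBall (0 : ℂ) r, d (z + t • e) ≠ 0 := fun t ht => hno t ht (hin z hz1 t ht)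
  have hdiff : DifferentiableOn ℂ (fun t : ℂ => (d (z + t • e))⁻¹) (closedBall 0 r) :=
    DifferentiableOn.inv (hd.comp (f := fun t : ℂ => z + t • e) (by fun_prop) fun t ht => hin z hz1 t ht) hno'
  have hcl : DiffContOnCl ℂ (fun t : ℂ => (d (z + t • e))⁻¹) (ball 0 r) :=
    DifferentiableOn.diffContOnCl (by rwa [closure_ball _ hr.ne'])
  have hb := Complex.norm_le_of_forall_mem_frontier_norm_le isBounded_ball hcl (C := (m / 2)⁻¹)
    (fun t ht => by
      rw [frontier_ball _ hr.ne'] at ht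
      have h1 : m / 2 < ‖d (z + t • e)‖ := (hin₂ z hz2 t ht).2
      rw [norm_inv]
      gcongr) (subset_closure (mem_ball_self hr))
  have hz0 := hno' 0 (mem_closedBall_self hr.le)
  simp only [zero_smul, add_zero] at hb hz0
  rw [norm_inv, inv_le_inv₀ (norm_pos_iff.2 hz0) (by positivity)] at hb
  linarith

/-- Near a point `a` lying on a line on which `f` and `g` do not vanish except at `a`, either `f`
and `g` have a common factor vanishing at `a`, or the projection of their common zeros is contained
in the zero set of a nonzero holomorphic function. -/
theorem exists_common_factor_or_resultant {E : Type*} [NormedAddCommGroup E] [NormedSpace ℂ E]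
    {f g : E → ℂ} {U : Set E} (hU : IsOpen U) (hf : DifferentiableOn ℂ f U)
    (hg : DifferentiableOn ℂ g U) {a e : E} {R : ℝ} (hR : 0 < R)
    (hline : ∀ t ∈ closedBall (0 : ℂ) R, a + t • e ∈ U)
    (hfe : ∀ t ∈ closedBall (0 : ℂ) R, t ≠ 0 → f (a + t • e) ≠ 0)
    (hge : ∀ t ∈ closedBall (0 : ℂ) R, t ≠ 0 → g (a + t • e) ≠ 0) :
    ∃ ε > 0, ball a ε ⊆ U ∧
      (∀ z ∈ ball a ε, ∃ᶠ t in nhds (0 : ℂ), f (z + t • e) ≠ 0) ∧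
      ((∃ d p q : E → ℂ, DifferentiableOn ℂ d (ball a ε) ∧ DifferentiableOn ℂ p (ball a ε) ∧
          DifferentiableOn ℂ q (ball a ε) ∧ d a = 0 ∧
          ∀ z ∈ ball a ε, f z = d z * p z ∧ g z = d z * q z) ∨
        ∃ c : E → ℂ, DifferentiableOn ℂ c (ball a ε) ∧ (∃ z ∈ ball a ε, c z ≠ 0) ∧
          ∀ z ∈ ball a ε, ∀ t ∈ closedBall (0 : ℂ) R,
            f (z + t • e) = 0 → g (z + t • e) = 0 → c z = 0) := by
  obtain ⟨ε₁, hε₁, N, W, v, hWm, hWN, hWc, hWa, hv, hfv, hin, hWz⟩ :=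
    exists_weierstrass_polynomial hU hf hR hline hfe
  obtain ⟨ε₂, hε₂, N', W', v', hWm', hWN', hWc', -, hv', hgv, -, hWz'⟩ :=
    exists_weierstrass_polynomial hU hg hR hline hge
  have hε : 0 < min ε₁ ε₂ := lt_min hε₁ hε₂
  have hs₁ : ball a (min ε₁ ε₂) ⊆ ball a ε₁ := ball_subset_ball (min_le_left _ _)
  have hs₂ : ball a (min ε₁ ε₂) ⊆ ball a ε₂ := ball_subset_ball (min_le_right _ _)
  have ha : a ∈ ball a (min ε₁ ε₂) := mem_ball_self hε
  refine ⟨min ε₁ ε₂, hε, fun z hz => ?_, fun z hz => ?_, ?_⟩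
  · simpa using hin z (hs₁ hz) 0 (mem_closedBall_self hR.le)
  · intro hev
    have h1 : {t : ℂ | (W z).IsRoot t} ∈ nhds 0 := by
      filter_upwards [hev, closedBall_mem_nhds (0 : ℂ) hR] with t ht htR
      exact hWz z (hs₁ hz) t htR (not_not.1 ht)
    exact (hWm z (hs₁ hz)).ne_zero
      (Polynomial.eq_zero_of_infinite_isRoot _ (infinite_of_mem_nhds 0 h1))
  · have hdom := holoRing.isDomain (E := E) isOpen_ball (convex_ball a (min ε₁ ε₂)) ⟨a, ha⟩
    have hic := holoRing.isIntegrallyClosed (E := E) isOpen_ball (convex_ball a (min ε₁ ε₂)) ⟨a, ha⟩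
    obtain ⟨F, hFm, hF⟩ := exists_monic_holoRing_map_evalAt (fun z hz => hWm z (hs₁ hz))
      (fun z hz => hWN z (hs₁ hz)) fun k => (hWc k).mono hs₁
    obtain ⟨G, -, hG⟩ := exists_monic_holoRing_map_evalAt (fun z hz => hWm' z (hs₂ hz))
      (fun z hz => hWN' z (hs₂ hz)) fun k => (hWc' k).mono hs₂
    rcases exists_bezout_or_common_factor (G := G) hFm with ⟨α, β, c, hc, hαβ⟩ | ⟨h, hhm, hdeg, hhF, hhG⟩
    · right
      refine ⟨holoRing.ext c, holoRing.differentiableOn_ext c, holoRing.exists_ext_ne_zero hc,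
        fun z hz t ht hft hgt => ?_⟩
      have h1 := congrArg (fun P => (P.map (holoRing.evalAt ⟨z, hz⟩)).eval t) hαβ
      simp only [Polynomial.map_add, Polynomial.map_mul, Polynomial.map_C, hF, hG,
        Polynomial.eval_add, Polynomial.eval_mul, Polynomial.eval_C, hWz z (hs₁ hz) t ht hft,
        hWz' z (hs₂ hz) t ht hgt, mul_zero, add_zero] at h1
      rw [← holoRing.evalAt_eq_ext c ⟨z, hz⟩, ← h1]
    · left
      obtain ⟨P, rfl⟩ := hhF
      obtain ⟨Q, rfl⟩ := hhG
      refine ⟨holoRing.ext (h.coeff 0), fun z => holoRing.ext (P.coeff 0) z * v z,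
        fun z => holoRing.ext (Q.coeff 0) z * v' z, holoRing.differentiableOn_ext _,
        (holoRing.differentiableOn_ext _).mul (hv.mono hs₁),
        (holoRing.differentiableOn_ext _).mul (hv'.mono hs₂), ?_, fun z hz => ⟨?_, ?_⟩⟩
      · have h1 := hF ⟨a, ha⟩
        rw [Polynomial.map_mul, hWa] at h1
        obtain ⟨t, ht⟩ := Complex.exists_root (f := h.map (holoRing.evalAt ⟨a, ha⟩)) (by
          rw [hhm.degree_map]
          exact Polynomial.natDegree_pos_iff_degree_pos.1 (Nat.pos_of_ne_zero hdeg))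
        have h2 := congrArg (Polynomial.eval t) h1
        rw [Polynomial.eval_mul, ht.eq_zero, zero_mul, Polynomial.eval_pow, Polynomial.eval_X] at h2
        have h3 : t = 0 := eq_zero_of_pow_eq_zero h2.symm
        rw [h3, Polynomial.IsRoot.def, ← Polynomial.coeff_zero_eq_eval_zero,
          Polynomial.coeff_map, holoRing.evalAt_eq_ext] at ht
        exact ht
      · have h1 := hF ⟨z, hz⟩
        rw [hfv z (hs₁ hz), ← h1, ← Polynomial.coeff_zero_eq_eval_zero, Polynomial.coeff_map,
          Polynomial.mul_coeff_zero, map_mul, holoRing.evalAt_eq_ext, holoRing.evalAt_eq_ext,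
          mul_assoc]
      · have h1 := hG ⟨z, hz⟩
        rw [hgv z (hs₂ hz), ← h1, ← Polynomial.coeff_zero_eq_eval_zero, Polynomial.coeff_map,
          Polynomial.mul_coeff_zero, map_mul, holoRing.evalAt_eq_ext, holoRing.evalAt_eq_ext,
          mul_assoc]

theorem relativelyPrime_isOpen
    (f g : EllTwo → ℂ) (U : Set EllTwo) (hU : IsOpen U) (a : EllTwo) (haU : a ∈ U)
    (hf : DifferentiableOn ℂ f U) (hg : DifferentiableOn ℂ g U)
    (hprime : RelativelyPrimeAt f g a) :
    ∃ 𝒰 : Set EllTwo, IsOpen 𝒰 ∧ a ∈ 𝒰 ∧ 𝒰 ⊆ U ∧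
      ∀ y ∈ 𝒰, RelativelyPrimeAt f g y := by
  by_cases hfa : f a = 0
  swap
  · refine ⟨U ∩ f ⁻¹' {0}ᶜ, hf.continuousOn.isOpen_inter_preimage hU isOpen_compl_singleton,
      ⟨haU, hfa⟩, inter_subset_left, ?_⟩
    rintro y hy ⟨V, d, p, q, -, hyV, -, -, -, hdy, h⟩
    exact hy.2 (by simp [(h y hyV).1, hdy])
  by_cases hga : g a = 0
  swap
  · refine ⟨U ∩ g ⁻¹' {0}ᶜ, hg.continuousOn.isOpen_inter_preimage hU isOpen_compl_singleton,
      ⟨haU, hga⟩, inter_subset_left, ?_⟩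
    rintro y hy ⟨V, d, p, q, -, hyV, -, -, -, hdy, h⟩
    exact hy.2 (by simp [(h y hyV).2, hdy])
  obtain ⟨δ, hδ, hδU⟩ := Metric.isOpen_iff.1 hU a haU
  have haδ : a ∈ ball a δ := mem_ball_self hδ
  obtain ⟨z₁, hz₁, hfz₁⟩ : ∃ z ∈ ball a δ, f z ≠ 0 := by
    by_contra! h0
    exact hprime ⟨ball a δ, g, fun _ => 0, fun _ => 1, isOpen_ball, haδ, hg.mono hδU,
      differentiableOn_const 0, differentiableOn_const 1, hga, fun z hz => by simp [h0 z hz]⟩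
  obtain ⟨z₂, hz₂, hgz₂⟩ : ∃ z ∈ ball a δ, g z ≠ 0 := by
    by_contra! h0
    exact hprime ⟨ball a δ, f, fun _ => 1, fun _ => 0, isOpen_ball, haδ, hf.mono hδU,
      differentiableOn_const 1, differentiableOn_const 0, hfa, fun z hz => by simp [h0 z hz]⟩
  obtain ⟨z, hfz, hgz, hz⟩ : ∃ z, f z ≠ 0 ∧ g z ≠ 0 ∧ z ∈ ball a δ :=
    ((frequently_ne_zero_of_differentiableOn isOpen_ball (convex_ball a δ) (hf.mono hδU) hz₂ hz₁
      hfz₁).and_eventually (((hg.continuousOn.continuousAt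
        (hU.mem_nhds (hδU hz₂))).eventually_ne hgz₂).and (isOpen_ball.mem_nhds hz₂))).exists
  set e := z - a
  have hfe := eventually_line_ne_zero isOpen_ball (convex_ball a δ) (hf.mono hδU) haδ hz hfz
  have hge := eventually_line_ne_zero isOpen_ball (convex_ball a δ) (hg.mono hδU) haδ hz hgz
  rw [eventually_nhdsWithin_iff] at hfe hge
  have hUe : ∀ᶠ t : ℂ in nhds 0, a + t • e ∈ U :=
    (hU.preimage (f := fun t : ℂ => a + t • e) (by fun_prop)).mem_nhds (by simpa using haU)
  obtain ⟨R, hR, hRs⟩ := Metric.nhds_basis_closedBall.mem_iff.1 (hUe.and (hfe.and hge))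
  obtain ⟨ε, hε, hεU, hfreq, hdich⟩ := exists_common_factor_or_resultant hU hf hg hR
    (fun t ht => (hRs ht).1) (fun t ht => (hRs ht).2.1) fun t ht => (hRs ht).2.2
  have haε : a ∈ ball a ε := mem_ball_self hε
  rcases hdich with ⟨d, p, q, hd, hp, hq, hda, h⟩ | ⟨c, hc, ⟨w, hw, hcw⟩, hzero⟩
  · exact absurd ⟨ball a ε, d, p, q, isOpen_ball, haε, hd, hp, hq, hda, h⟩ hprime
  refine ⟨ball a ε, isOpen_ball, haε, hεU, ?_⟩
  rintro y hy ⟨V, d, p, q, hV, hyV, hd, -, -, hdy, h⟩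
  have hVe : ∀ᶠ t : ℂ in nhds 0, y + t • e ∈ V :=
    (hV.preimage (f := fun t : ℂ => y + t • e) (by fun_prop)).mem_nhds (by simpa using hyV)
  have hde : ∀ᶠ t in nhdsWithin (0 : ℂ) {0}ᶜ, d (y + t • e) ≠ 0 := by
    refine ((analyticOnNhd_comp_line hV hd y e) 0
      (by simpa using hyV)).eventually_eq_zero_or_eventually_ne_zero.resolve_left fun h0 => ?_
    refine hfreq y hy ?_
    filter_upwards [h0, hVe] with t ht htV
    rw [(h _ htV).1, ht, zero_mul]
    simp
  rw [eventually_nhdsWithin_iff] at hde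
  obtain ⟨r, hr, hrs⟩ := Metric.nhds_basis_closedBall.mem_iff.1
    (hVe.and (hde.and (closedBall_mem_nhds (0 : ℂ) hR)))
  have hex := eventually_exists_zero_on_line hV hd hr (fun t ht => (hrs ht).1)
    (fun t ht => (hrs (sphere_subset_closedBall ht)).2.1 (ne_of_mem_sphere ht hr.ne')) hdy
  obtain ⟨x, hx, ⟨t, ht, htV, hdt⟩, hxε⟩ := ((frequently_ne_zero_of_differentiableOn isOpen_ball
    (convex_ball a ε) hc hy hw hcw).and_eventually (hex.and (isOpen_ball.mem_nhds hy))).exists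
  refine hx (hzero x hxε t (hrs ht).2.2 ?_ ?_)
  · rw [(h _ htV).1, hdt, zero_mul]
  · rw [(h _ htV).2, hdt, zero_mul]
end
end
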